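/- arXiv:2603.20550 — 3 statements merged into one kernel-verified Lean document; each statement's English description precedes it below -/
import Mathlib

section
/- The sum over all 4-tuples (a₁, a₂, a₃, a₄) of nonzero integers with a₁ + a₂ + a₃ + a₄ = 0 of 1/|a₁ a₂ a₃ a₄| equals 12(ζ(2)² + 7ζ(4)) = (19/15)π⁴, where ζ is the Riemann zeta function. -/
/-- `ζ̄_4`: the sum of `1/|a₁ a₂ a₃ a₄|` over all 4-tuples of nonzero integers with
`a₁ + a₂ + a₃ + a₄ = 0`. -/
noncomputable def symMT4 : ℝ :=
  ∑' a : {a : Fin 4 → ℤ // (∀ i, a i ≠ 0) ∧ ∑ i, a i = 0},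
    1 / |∏ i, ((a.1 i : ℝ))|

namespace MT4
open scoped ENNReal
open Finset

/-- `1/(n+1)` as an extended nonnegative real. -/
noncomputable def r (n : ℕ) : ℝ≥0∞ := ENNReal.ofReal (1 / ((n : ℝ) + 1))
/-- harmonic numbers -/
noncomputable def h (n : ℕ) : ℝ≥0∞ := ∑ k ∈ range n, r k
/-- second order harmonic numbers -/
noncomputable def q (n : ℕ) : ℝ≥0∞ := ∑ k ∈ range n, r k ^ 2
/-- nested harmonic sums -/
noncomputable def t (n : ℕ) : ℝ≥0∞ := ∑ k ∈ range n, r k * h k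

lemma pf (a b : ℕ) : r a * r b = (r a + r b) * r (a + b + 1) := by
  unfold r
  rw [← ENNReal.ofReal_add (by positivity) (by positivity), ← ENNReal.ofReal_mul (by positivity),
    ← ENNReal.ofReal_mul (by positivity)]
  congr 1
  push_cast
  field_simp
  ring

lemma shift (f : ℕ → ℕ → ℝ≥0∞) :
    ∑' a, ∑' b, f a (a + b + 1) = ∑' m, ∑ a ∈ range m, f a m := by
  have h1 : ∀ m, ∑ a ∈ range m, f a m = ∑' a, if a < m then f a m else 0 := by
    intro m
    rw [tsum_eq_sum (s := range m)]
    · exact sum_congr rfl (fun a ha => by simp [mem_range.1 ha])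
    · intro b hb
      simp at hb
      simp [hb]
  simp_rw [h1]
  rw [ENNReal.tsum_comm (f := fun m a => if a < m then f a m else 0)]
  congr 1
  ext a
  rw [← (ENNReal.summable (f := fun n => (fun m => if a < m then f a m else 0) (n + (a+1)))).sum_add_tsum_nat_add' (f := fun m => if a < m then f a m else 0)]
  rw [sum_eq_zero, zero_add]
  · congr 1
    ext b
    have : a < b + (a + 1) := by omega
    simp only [this, if_true]
    congr 1
    omega
  · intro m hm
    have := mem_range.1 hm
    rw [if_neg (by omega)]

lemma split3 (g : ℕ → ℝ≥0∞) (a : ℕ) :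
    ∑' b, g b = ∑ b ∈ range a, g b + g a + ∑' j, g (a + j + 1) := by
  rw [← (ENNReal.summable (f := fun n => g (n + (a+1)))).sum_add_tsum_nat_add', sum_range_succ]
  congr 2
  ext j
  congr 1
  omega

lemma tele (M : ℕ) : ∑' c, r (c + M) * r (c + M + 1) = r M := by
  have hs : HasSum (fun c : ℕ => (1 / (((c + M : ℕ) : ℝ) + 1)) * (1 / (((c + M + 1 : ℕ) : ℝ) + 1)))
      (1 / ((M : ℝ) + 1)) := by
    rw [hasSum_iff_tendsto_nat_of_nonneg (fun _ => by positivity)]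
    have hp : ∀ n : ℕ, ∑ c ∈ range n, (1 / (((c + M : ℕ) : ℝ) + 1)) *
        (1 / (((c + M + 1 : ℕ) : ℝ) + 1)) = 1 / ((M : ℝ) + 1) - 1 / (((n + M : ℕ) : ℝ) + 1) := by
      intro n
      induction n with
      | zero => simp
      | succ n ih =>
        rw [sum_range_succ, ih]
        push_cast
        field_simp
        ring
    simp_rw [hp]
    have h0 := (Filter.tendsto_add_atTop_iff_nat M).2
      (tendsto_one_div_add_atTop_nhds_zero_nat (𝕜 := ℝ))
    simpa using h0.const_sub (1 / ((M : ℝ) + 1))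
  unfold r
  simp_rw [← ENNReal.ofReal_mul (show (0:ℝ) ≤ 1 / (((_ : ℕ) : ℝ) + 1) by positivity)]
  rw [← ENNReal.ofReal_tsum_of_nonneg (fun _ => by positivity) hs.summable, hs.tsum_eq]

lemma T0 (m : ℕ) : ∑' c, ((m + 1 : ℕ) : ℝ≥0∞) * (r c * r (c + m + 1)) = h (m + 1) := by
  induction m with
  | zero => simpa [h] using tele 0
  | succ m ih =>
    have e : ∀ c, ((m + 1 + 1 : ℕ) : ℝ≥0∞) * (r c * r (c + (m + 1) + 1)) =
        ((m + 1 : ℕ) : ℝ≥0∞) * (r c * r (c + m + 1)) + r (c + (m+1)) * r (c + (m+1) + 1) := by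
      intro c
      unfold r
      rw [← ENNReal.ofReal_natCast, ← ENNReal.ofReal_natCast]
      simp only [← ENNReal.ofReal_mul (show (0:ℝ) ≤ 1 / (((_ : ℕ) : ℝ) + 1) by positivity),
        ← ENNReal.ofReal_mul (show (0:ℝ) ≤ ((_ : ℕ) : ℝ) by positivity)]
      rw [← ENNReal.ofReal_add (by positivity) (by positivity)]
      congr 1
      push_cast
      field_simp
      ring
    simp_rw [e]
    rw [ENNReal.tsum_add, ih, tele, h, h, sum_range_succ _ (m + 1)]

lemma r_mul (m : ℕ) : r m * ((m + 1 : ℕ) : ℝ≥0∞) = 1 := by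
  unfold r
  rw [← ENNReal.ofReal_natCast, ← ENNReal.ofReal_mul (by positivity)]
  push_cast
  rw [one_div, inv_mul_cancel₀ (by positivity)]
  simp

lemma T1 (m : ℕ) : ∑' c, r c * r (c + m + 1) = r m * h (m + 1) := by
  rw [← T0, ENNReal.tsum_mul_left, ← mul_assoc, r_mul, one_mul]

lemma hsucc (m : ℕ) : h (m + 1) = h m + r m := sum_range_succ _ _

lemma h_sq (m : ℕ) : h m ^ 2 = 2 * t m + q m := by
  induction m with
  | zero => simp [h, t, q]
  | succ m ih =>
    have ht : t (m + 1) = t m + r m * h m := sum_range_succ _ _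
    have hq : q (m + 1) = q m + r m ^ 2 := sum_range_succ _ _
    rw [hsucc, ht, hq, show (h m + r m) ^ 2 = h m ^ 2 + 2 * (r m * h m) + r m ^ 2 by ring, ih]
    ring

noncomputable def V : ℝ≥0∞ := ∑' m, r m ^ 2
noncomputable def W : ℝ≥0∞ := ∑' m, r m ^ 4
noncomputable def X : ℝ≥0∞ := ∑' m, r m ^ 2 * h m ^ 2
noncomputable def Y : ℝ≥0∞ := ∑' m, r m ^ 3 * h m
noncomputable def Z : ℝ≥0∞ := ∑' m, r m ^ 2 * q m
noncomputable def A : ℝ≥0∞ := ∑' m, r m ^ 2 * t m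

lemma X_eq : X = 2 * A + Z := by
  unfold X A Z
  rw [← ENNReal.tsum_mul_left, ← ENNReal.tsum_add]
  congr 1; ext m
  rw [h_sq]; ring

lemma V_sq : V ^ 2 = 2 * Z + W := by
  have h1 : V ^ 2 = ∑' a, ∑' b, r a ^ 2 * r b ^ 2 := by
    simp_rw [ENNReal.tsum_mul_left, ENNReal.tsum_mul_right]
    rw [sq]; rfl
  rw [h1]
  have h2 : ∀ a, ∑' b, r a ^ 2 * r b ^ 2 = r a ^ 2 * q a + r a ^ 4 +
      ∑' j, r a ^ 2 * r (a + j + 1) ^ 2 := by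
    intro a
    rw [split3 _ a, q, mul_sum]
    congr 2
    ring
  simp_rw [h2, ENNReal.tsum_add]
  rw [shift (fun a m => r a ^ 2 * r m ^ 2)]
  have h3 : ∀ m, ∑ a ∈ range m, r a ^ 2 * r m ^ 2 = r m ^ 2 * q m := by
    intro m
    rw [q, mul_sum]; exact sum_congr rfl (fun _ _ => mul_comm _ _)
  simp_rw [h3]
  unfold Z W
  ring

lemma sumY : ∑' a, ∑' b, r a * r (a + b + 1) ^ 3 = Y := by
  rw [shift (fun a m => r a * r m ^ 3)]
  unfold Y
  congr 1; ext m
  rw [h, mul_sum]; exact sum_congr rfl (fun _ _ => mul_comm _ _)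

lemma symm2 (f g : ℕ → ℝ≥0∞) :
    ∑' a, ∑' b, f b * g (a + b + 1) = ∑' a, ∑' b, f a * g (a + b + 1) := by
  rw [ENNReal.tsum_comm]
  simp_rw [add_comm]

lemma euler0 : W + Y = Z + 2 * Y := by
  have h1 : ∑' a, ∑' b, r a ^ 2 * (r b * r (b + a + 1)) = W + Y := by
    simp_rw [ENNReal.tsum_mul_left, T1, hsucc]
    unfold W Y
    rw [← ENNReal.tsum_add]
    congr 1; ext m; ring
  have h2 : ∀ a b, r a ^ 2 * (r b * r (b + a + 1)) = r a ^ 2 * r (a + b + 1) ^ 2 +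
      (r a * r (a + b + 1) ^ 3 + r b * r (a + b + 1) ^ 3) := by
    intro a b
    rw [add_comm b a]
    calc _ = r a * (r a * r b) * r (a + b + 1) := by ring
      _ = r a * ((r a + r b) * r (a + b + 1)) * r (a + b + 1) := by rw [← pf]
      _ = r a ^ 2 * r (a + b + 1) ^ 2 + (r a * r b) * r (a + b + 1) ^ 2 := by ring
      _ = _ := by rw [pf]; ring
  rw [← h1]
  simp_rw [h2, ENNReal.tsum_add]
  rw [symm2 r (fun m => r m ^ 3), sumY, shift (fun a m => r a ^ 2 * r m ^ 2)]
  have h3 : ∀ m, ∑ a ∈ range m, r a ^ 2 * r m ^ 2 = r m ^ 2 * q m := by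
    intro m
    rw [q, mul_sum]; exact sum_congr rfl (fun _ _ => mul_comm _ _)
  simp_rw [h3]
  unfold Z
  ring

lemma sumhh : ∑' a, ∑' b, r a * r b * ∑' c, r c * r (c + (a + b + 1) + 1) = 2 * X + 2 * Y := by
  simp_rw [T1]
  have h2 : ∀ a b, r a * r b * (r (a + b + 1) * h (a + b + 1 + 1)) =
      r a * (r (a + b + 1) ^ 2 * h (a + b + 1 + 1)) +
      r b * (r (a + b + 1) ^ 2 * h (a + b + 1 + 1)) := by
    intro a b; rw [pf]; ring
  simp_rw [h2, ENNReal.tsum_add]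
  rw [symm2 r (fun m => r m ^ 2 * h (m + 1)), shift (fun a m => r a * (r m ^ 2 * h (m + 1)))]
  have h3 : ∀ m, ∑ a ∈ range m, r a * (r m ^ 2 * h (m + 1)) =
      r m ^ 2 * h m ^ 2 + r m ^ 3 * h m := by
    intro m
    rw [← sum_mul, ← h, hsucc]; ring
  simp_rw [h3, ENNReal.tsum_add]
  unfold X Y
  ring

lemma sumA : ∑' a, ∑' b, ∑' c, r a * r (a + b + 1) * r (a + b + 1 + c + 1) ^ 2 = A := by
  rw [shift (fun a m => ∑' c, r a * r m * r (m + c + 1) ^ 2)]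
  have h1 : ∀ m, ∑ a ∈ range m, ∑' c, r a * r m * r (m + c + 1) ^ 2 =
      ∑' c, r m * h m * r (m + c + 1) ^ 2 := by
    intro m
    simp_rw [ENNReal.tsum_mul_left]
    rw [← sum_mul, ← sum_mul, ← h, mul_comm (h m)]
  simp_rw [h1]
  rw [shift (fun a m => r a * h a * r m ^ 2)]
  unfold A
  congr 1; ext m
  rw [← sum_mul, ← t, mul_comm]

lemma B3 : ∑' a, ∑' b, ∑' c, r a * r b * r (a + b + 1 + c + 1) ^ 2 = 2 * A := by
  have h2 : ∀ a b c, r a * r b * r (a + b + 1 + c + 1) ^ 2 =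
     r a * (r (a + b + 1) * r (a + b + 1 + c + 1) ^ 2)
      + r b * (r (a + b + 1) * r (a + b + 1 + c + 1) ^ 2) := by
    intro a b c; rw [pf]; ring
  have := symm2 r (fun m => ∑' c, r m * r (m + c + 1) ^ 2)
  simp_rw [h2, ENNReal.tsum_add]
  simp_rw [← ENNReal.tsum_mul_left] at this
  rw [this, ← sumA]
  simp_rw [mul_assoc]
  ring

lemma sumhh' : ∑' a, ∑' b, r a * r b * ∑' c, r c * r (c + (a + b + 1) + 1) = 6 * A := by
  have h2 : ∀ a b c, r a * r b * (r c * r (c + (a + b + 1) + 1)) =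
     r a * r b * r (a + b + 1 + c + 1) ^ 2 + (r a * r c * r (a + c + 1 + b + 1) ^ 2
      + r b * r c * r (b + c + 1 + a + 1) ^ 2) := by
    intro a b c
    rw [show a + c + 1 + b + 1 = a + b + 1 + c + 1 by omega,
      show b + c + 1 + a + 1 = a + b + 1 + c + 1 by omega,
      show c + (a + b + 1) + 1 = a + b + 1 + c + 1 by omega]
    have e := pf (a + b + 1) c
    calc _ = (r a * r b) * r c * r (a + b + 1 + c + 1) := by ring
      _ = (r a + r b) * (r (a + b + 1) * r c) * r (a + b + 1 + c + 1) := by rw [pf a b]; ring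
      _ = ((r a + r b) * r (a + b + 1)) * r (a + b + 1 + c + 1) ^ 2
          + (r a + r b) * r c * r (a + b + 1 + c + 1) ^ 2 := by rw [e]; ring
      _ = _ := by rw [← pf]; ring
  simp_rw [← ENNReal.tsum_mul_left, h2, ENNReal.tsum_add]
  have e1 : ∑' a, ∑' b, ∑' c, r a * r c * r (a + c + 1 + b + 1) ^ 2 = 2 * A := by
    rw [← B3]
    congr 1; ext a
    rw [ENNReal.tsum_comm]
  have e2 : ∑' a, ∑' b, ∑' c, r b * r c * r (b + c + 1 + a + 1) ^ 2 = 2 * A := by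
    rw [← B3, ENNReal.tsum_comm]
    congr 1; ext a
    rw [ENNReal.tsum_comm]
  rw [e1, e2, B3]
  ring

lemma r_ne_top (m : ℕ) : r m ≠ ⊤ := ENNReal.ofReal_ne_top

lemma V_eq : V = ENNReal.ofReal (Real.pi ^ 2 / 6) := by
  have := (hasSum_nat_add_iff' 1).2 hasSum_zeta_two
  simp only [sum_range_one, Nat.cast_zero] at this
  norm_num at this
  rw [← this.tsum_eq, ENNReal.ofReal_tsum_of_nonneg (fun _ => by positivity) this.summable, V]
  congr 1; ext m
  rw [r, ← ENNReal.ofReal_pow (by positivity)]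
  congr 1
  simp

lemma W_eq : W = ENNReal.ofReal (Real.pi ^ 4 / 90) := by
  have := (hasSum_nat_add_iff' 1).2 hasSum_zeta_four
  simp only [sum_range_one, Nat.cast_zero] at this
  norm_num at this
  rw [← this.tsum_eq, ENNReal.ofReal_tsum_of_nonneg (fun _ => by positivity) this.summable, W]
  congr 1; ext m
  rw [r, ← ENNReal.ofReal_pow (by positivity)]
  congr 1
  simp

lemma h_bound (m : ℕ) : h m ≤ ENNReal.ofReal (5 * ((m : ℝ) + 1) ^ (1/4 : ℝ)) := by
  have h1 : h m = ENNReal.ofReal (harmonic m : ℝ) := by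
    unfold h r harmonic
    rw [← ENNReal.ofReal_sum_of_nonneg (fun _ _ => by positivity)]
    simp
  rw [h1]
  apply ENNReal.ofReal_le_ofReal
  refine (harmonic_le_one_add_log m).trans ?_
  have h2 : Real.log m ≤ Real.log ((m : ℝ) + 1) := by
    rcases Nat.eq_zero_or_pos m with rfl | hm
    · simp
    · exact Real.log_le_log (by exact_mod_cast hm) (by linarith)
  have h3 := Real.log_le_rpow_div (x := (m : ℝ) + 1) (by positivity) (ε := 1/4) (by norm_num)
  have h4 := Real.one_le_rpow (x := (m : ℝ) + 1) (z := 1/4) (by simp) (by norm_num)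
  linarith

lemma X_ne_top : X ≠ ⊤ := by
  have hs : Summable (fun m : ℕ => 25 * ((m : ℝ) + 1) ^ (-(3/2) : ℝ)) := by
    have := (summable_nat_add_iff 1).2 (Real.summable_nat_rpow.2 (show (-(3/2) : ℝ) < -1 by norm_num))
    push_cast at this
    exact this.mul_left _
  refine ne_top_of_le_ne_top (hs.tsum_ofReal_ne_top) ?_
  unfold X
  refine ENNReal.tsum_le_tsum (fun m => ?_)
  calc r m ^ 2 * h m ^ 2 ≤ r m ^ 2 * ENNReal.ofReal (5 * ((m : ℝ) + 1) ^ (1/4 : ℝ)) ^ 2 := by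
        gcongr; exact h_bound m
    _ = _ := by
      rw [r, ← ENNReal.ofReal_pow (by positivity), ← ENNReal.ofReal_pow (by positivity),
        ← ENNReal.ofReal_mul (by positivity)]
      congr 1
      have hp : (0:ℝ) < (m : ℝ) + 1 := by positivity
      rw [mul_pow, ← Real.rpow_natCast (_ ^ _) 2, ← Real.rpow_mul hp.le, one_div, inv_pow,
        ← Real.rpow_natCast _ 2, ← Real.rpow_neg hp.le, mul_left_comm, ← Real.rpow_add hp]
      norm_num

lemma Z_ne_top : Z ≠ ⊤ := by
  have := V_sq
  intro h
  rw [h, V_eq, ← ENNReal.ofReal_pow (by positivity)] at this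
  simp [ENNReal.mul_top] at this

lemma key : 2 * X + 2 * Y = 6 * A := sumhh.symm.trans sumhh'

lemma A_ne_top : A ≠ ⊤ := by
  intro hA
  have := X_eq
  rw [hA] at this
  simp [ENNReal.mul_top] at this
  exact X_ne_top this

lemma Y_ne_top : Y ≠ ⊤ := by
  intro hY
  have := key
  rw [hY] at this
  simp [ENNReal.mul_top] at this
  exact (ENNReal.mul_ne_top (by simp) A_ne_top) this.symm

lemma total : 4 * V ^ 2 + 32 * X + 32 * Y + 8 * W = ENNReal.ofReal (19 / 15 * Real.pi ^ 4) := by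
  have e1 := congrArg ENNReal.toReal key
  have e2 := congrArg ENNReal.toReal X_eq
  have e3 := congrArg ENNReal.toReal euler0
  have e4 := congrArg ENNReal.toReal V_sq
  have hW : W ≠ ⊤ := by rw [W_eq]; exact ENNReal.ofReal_ne_top
  have hV : V ≠ ⊤ := by rw [V_eq]; exact ENNReal.ofReal_ne_top
  have hWr : W.toReal = Real.pi ^ 4 / 90 := by rw [W_eq, ENNReal.toReal_ofReal (by positivity)]
  have hVr : V.toReal = Real.pi ^ 2 / 6 := by rw [V_eq, ENNReal.toReal_ofReal (by positivity)]
  have m2 : ∀ (c : ℝ≥0∞) (x : ℝ≥0∞), c ≠ ⊤ → x ≠ ⊤ → c * x ≠ ⊤ :=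
    fun _ _ => ENNReal.mul_ne_top
  have hX := X_ne_top
  have hY := Y_ne_top
  have hZ := Z_ne_top
  have hA := A_ne_top
  have hV2 : V ^ 2 ≠ ⊤ := ENNReal.pow_ne_top hV
  have h2X := m2 2 X (by simp) hX
  have h2Y := m2 2 Y (by simp) hY
  have h2Z := m2 2 Z (by simp) hZ
  have h2A := m2 2 A (by simp) hA
  have h4V := m2 4 (V ^ 2) (by simp) hV2
  have h32X := m2 32 X (by simp) hX
  have h32Y := m2 32 Y (by simp) hY
  have h8W := m2 8 W (by simp) hW
  rw [ENNReal.toReal_add h2X h2Y] at e1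
  rw [ENNReal.toReal_add h2A hZ] at e2
  rw [ENNReal.toReal_add hW hY, ENNReal.toReal_add hZ h2Y] at e3
  rw [ENNReal.toReal_add h2Z hW] at e4
  rw [← ENNReal.toReal_eq_toReal_iff' (by simp [*]) ENNReal.ofReal_ne_top,
    ENNReal.toReal_ofReal (by positivity),
    ENNReal.toReal_add (by simp [*]) h8W, ENNReal.toReal_add (by simp [*]) h32Y,
    ENNReal.toReal_add h4V h32X]
  simp only [ENNReal.toReal_mul, ENNReal.toReal_pow, ENNReal.toReal_ofNat] at *
  rw [hWr] at *
  rw [hVr] at *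
  linarith

/-- `1/|a|` as an extended nonnegative real, with value `0` at `0`. -/
noncomputable def w (a : ℤ) : ℝ≥0∞ := ENNReal.ofReal (1 / |(a : ℝ)|)

lemma w_zero : w 0 = 0 := by simp [w]
lemma w_neg (a : ℤ) : w (-a) = w a := by simp [w]
lemma w_pos (k : ℕ) : w ((k : ℤ) + 1) = r k := by
  unfold w r
  push_cast
  rw [abs_of_nonneg (by positivity)]

lemma w_pos' (a : ℤ) (k : ℕ) (h : a = (k : ℤ) + 1) : w a = r k := by rw [h, w_pos]
lemma w_neg' (a : ℤ) (k : ℕ) (h : a = -((k : ℤ) + 1)) : w a = r k := by rw [h, w_neg, w_pos]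

noncomputable def G (n : ℤ) : ℝ≥0∞ := ∑' a : ℤ, w a * w (n - a)

lemma tsumZ (f : ℤ → ℝ≥0∞) :
    ∑' a, f a = ∑' n : ℕ, f ((n : ℤ) + 1) + f 0 + ∑' n : ℕ, f (-((n : ℤ) + 1)) :=
  tsum_of_add_one_of_neg_add_one ENNReal.summable ENNReal.summable

lemma G_neg (n : ℤ) : G (-n) = G n := by
  unfold G
  rw [← (Equiv.neg ℤ).tsum_eq]
  congr 1; ext a
  simp only [Equiv.neg_apply]
  rw [w_neg, ← w_neg (n - a)]
  congr 2; ring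

lemma G_zero : G 0 = 2 * V := by
  unfold G
  rw [tsumZ]
  simp only [zero_sub, w_neg, w_pos, w_zero, neg_neg]
  unfold V
  simp_rw [sq]
  ring

lemma G_pos (m : ℕ) : G ((m : ℤ) + 1) = 4 * (r m * h m) + 2 * r m ^ 2 := by
  unfold G
  rw [tsumZ, split3 _ m]
  have e1 : ∑ b ∈ range m, w ((b : ℤ) + 1) * w ((m : ℤ) + 1 - ((b : ℤ) + 1)) = 2 * (r m * h m) := by
    have : ∀ b ∈ range m, w ((b : ℤ) + 1) * w ((m : ℤ) + 1 - ((b : ℤ) + 1)) =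
        r m * r b + r m * r (m - 1 - b) := by
      intro b hb
      have hb := mem_range.1 hb
      rw [w_pos, w_pos' _ (m - 1 - b) (by omega), pf, show b + (m - 1 - b) + 1 = m by omega]
      ring
    rw [sum_congr rfl this, sum_add_distrib, ← mul_sum, ← mul_sum, sum_range_reflect, ← h]
    ring
  have e2 : ∑' j : ℕ, w (((m + j + 1 : ℕ) : ℤ) + 1) *
      w ((m : ℤ) + 1 - (((m + j + 1 : ℕ) : ℤ) + 1)) = r m * h (m + 1) := by
    rw [← T1]
    congr 1; ext j
    rw [w_pos, w_neg' _ j (by push_cast; ring), mul_comm, add_comm m j]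
  have e3 : ∑' j : ℕ, w (-((j : ℤ) + 1)) * w ((m : ℤ) + 1 - -((j : ℤ) + 1)) = r m * h (m + 1) := by
    rw [← T1]
    congr 1; ext j
    rw [w_neg, w_pos, w_pos' _ (j + m + 1) (by push_cast; ring)]
  rw [e1, e2, e3]
  simp only [sub_self, w_zero, mul_zero, zero_mul, hsucc]
  ring

lemma sumG : ∑' n : ℤ, G n * G (-n) = 4 * V ^ 2 + 32 * X + 32 * Y + 8 * W := by
  have h1 : ∀ m : ℕ, G ((m : ℤ) + 1) * G ((m : ℤ) + 1) =
      16 * (r m ^ 2 * h m ^ 2) + 16 * (r m ^ 3 * h m) + 4 * r m ^ 4 := by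
    intro m; rw [G_pos]; ring
  rw [tsumZ]
  simp only [G_neg, h1, G_zero, ENNReal.tsum_add, ENNReal.tsum_mul_left]
  unfold X Y W
  ring

lemma sum3 : ∑' n : ℤ, G n * G (-n) =
    ∑' p : ℤ × ℤ × ℤ, w p.2.1 * w (p.1 - p.2.1) * (w p.2.2 * w (-p.1 - p.2.2)) := by
  rw [ENNReal.tsum_prod']
  congr 1; ext n
  rw [ENNReal.tsum_prod']
  simp_rw [ENNReal.tsum_mul_left, ENNReal.tsum_mul_right]
  rfl

/-- parametrisation of the index set -/
def par (a : {a : Fin 4 → ℤ // (∀ i, a i ≠ 0) ∧ ∑ i, a i = 0}) : ℤ × ℤ × ℤ :=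
  (a.1 0 + a.1 1, a.1 0, a.1 2)

lemma par_inj : Function.Injective par := by
  rintro ⟨a, ha, ha'⟩ ⟨b, hb, hb'⟩ hab
  simp only [par, Prod.mk.injEq] at hab
  rw [Fin.sum_univ_four] at ha' hb'
  apply Subtype.ext
  funext i
  fin_cases i <;> simp <;> omega

lemma sumsub : ∑' a : {a : Fin 4 → ℤ // (∀ i, a i ≠ 0) ∧ ∑ i, a i = 0},
    ENNReal.ofReal (1 / |∏ i, ((a.1 i : ℝ))|) = ENNReal.ofReal (19 / 15 * Real.pi ^ 4) := by
  rw [← total, ← sumG, sum3, ← par_inj.tsum_eq]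
  · congr 1
    ext ⟨a, ha, ha'⟩
    rw [Fin.sum_univ_four] at ha'
    simp only [par, Fin.prod_univ_four]
    rw [show a 0 + a 1 - a 0 = a 1 by ring, show -(a 0 + a 1) - a 2 = a 3 by omega]
    unfold w
    rw [← ENNReal.ofReal_mul (by positivity), ← ENNReal.ofReal_mul (by positivity),
      ← ENNReal.ofReal_mul (by positivity)]
    congr 1
    simp only [abs_mul, one_div, mul_inv]
    ring
  · rintro ⟨n, a, b⟩ hp
    simp only [Function.mem_support, ne_eq, mul_eq_zero, not_or] at hp
    obtain ⟨⟨h1, h2⟩, h3, h4⟩ := hp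
    have hw : ∀ c, ¬ w c = 0 → c ≠ 0 := by
      rintro c hc rfl
      exact hc w_zero
    refine ⟨⟨![a, n - a, b, -n - b], ?_, ?_⟩, ?_⟩
    · intro i
      fin_cases i
      · exact hw _ h1
      · exact hw _ h2
      · exact hw _ h3
      · exact hw _ h4
    · rw [Fin.sum_univ_four]
      simp
    · simp [par]

lemma main : symMT4 = 19 / 15 * Real.pi ^ 4 := by
  have h := congrArg ENNReal.toReal sumsub
  rw [ENNReal.tsum_toReal_eq (fun _ => ENNReal.ofReal_ne_top),
    ENNReal.toReal_ofReal (by positivity)] at h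
  rw [← h, symMT4]
  congr 1; ext a
  rw [ENNReal.toReal_ofReal (by positivity)]
end MT4

/-- `ζ̄_4 = 12(ζ(2)² + 7ζ(4)) = (19/15)π⁴`. -/
theorem symMT4_eq :
    (symMT4 : ℂ) = 12 * (riemannZeta 2 ^ 2 + 7 * riemannZeta 4) ∧
    symMT4 = 19 / 15 * Real.pi ^ 4 := by
  refine ⟨?_, MT4.main⟩
  rw [MT4.main, riemannZeta_two, riemannZeta_four]
  push_cast
  ring
end

section
/- The sum over all 5-tuples (a₁, …, a₅) of nonzero integers with a₁ + … + a₅ = 0 of 1/|a₁ a₂ a₃ a₄ a₅| equals 240(ζ(2)ζ(3) + 3ζ(5)), where ζ is the Riemann zeta function. -/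
/-- `ζ̄_5`: the sum of `1/|a₁ ⋯ a₅|` over all 5-tuples of nonzero integers with
`a₁ + … + a₅ = 0`. -/
noncomputable def symMT5 : ℝ :=
  ∑' a : {a : Fin 5 → ℤ // (∀ i, a i ≠ 0) ∧ ∑ i, a i = 0},
    1 / |∏ i, ((a.1 i : ℝ))|

open scoped ENNReal NNReal
open Finset

namespace MT5

/-- `1/n`, with value `0` at `n = 0`. -/
noncomputable def r (n : ℕ) : ℝ≥0∞ := ENNReal.ofReal ((n : ℝ)⁻¹)

lemma r_zero : r 0 = 0 := by simp [r]

lemma r_mul (n : ℕ) (h : n ≠ 0) : r n * (n : ℝ≥0∞) = 1 := by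
  have hn : (0 : ℝ) < n := by exact_mod_cast Nat.pos_of_ne_zero h
  rw [r, ← ENNReal.ofReal_natCast, ← ENNReal.ofReal_mul (by positivity), inv_mul_cancel₀ hn.ne']
  simp

noncomputable def P (g : ℕ → ℝ≥0∞) (n : ℕ) : ℝ≥0∞ := ∑ m ∈ range n, g m
noncomputable def M (g : ℕ → ℝ≥0∞) (n : ℕ) : ℝ≥0∞ := r n * g n
noncomputable def T (g : ℕ → ℝ≥0∞) : ℕ → ℝ≥0∞ := M (P g)
noncomputable def dl (n : ℕ) : ℝ≥0∞ := if n = 0 then 1 else 0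

lemma M_zero (g : ℕ → ℝ≥0∞) : M g 0 = 0 := by simp [M, r_zero]
lemma T_zero (g : ℕ → ℝ≥0∞) : T g 0 = 0 := M_zero _

lemma P_eq (g : ℕ → ℝ≥0∞) (n : ℕ) : P g n = ∑' m, if m < n then g m else 0 := by
  rw [P, tsum_eq_sum (s := range n)]
  · exact Finset.sum_congr rfl fun m hm => by simp [Finset.mem_range.1 hm]
  · intro m hm
    simp only [Finset.mem_range] at hm
    simp [hm]

/-- the connector -/
noncomputable def cr (m n : ℕ) : ℝ := ((Nat.choose (m + n) m : ℕ) : ℝ)⁻¹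
noncomputable def c (m n : ℕ) : ℝ≥0∞ := ENNReal.ofReal (cr m n)

lemma cr_comm (m n : ℕ) : cr m n = cr n m := by
  unfold cr; rw [Nat.choose_symm_add, add_comm]

lemma c_comm (m n : ℕ) : c m n = c n m := by rw [c, cr_comm, c]

lemma c_zero (m : ℕ) : c m 0 = 1 := by simp [c, cr]

lemma cr_nonneg (m n : ℕ) : 0 ≤ cr m n := by unfold cr; positivity

lemma cr_step (a n : ℕ) (hn : n ≠ 0) :
    ((a + 1 : ℕ) : ℝ)⁻¹ * cr (a + 1) n = (n : ℝ)⁻¹ * (cr a n - cr (a + 1) n) := by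
  have h := Nat.add_one_mul_choose_eq (a + n) a
  have h' : ((a + n + 1 : ℕ) : ℝ) * (Nat.choose (a + n) a : ℕ) =
    (Nat.choose (a + 1 + n) (a + 1) : ℕ) * ((a + 1 : ℕ) : ℝ) := by
    rw [show a + 1 + n = a + n + 1 by ring]; exact_mod_cast h
  have p1 : (0 : ℝ) < (Nat.choose (a + n) a : ℕ) := by
    exact_mod_cast Nat.choose_pos (by omega)
  have p2 : (0 : ℝ) < (Nat.choose (a + 1 + n) (a + 1) : ℕ) := by
    exact_mod_cast Nat.choose_pos (by omega)
  have hn' : (0 : ℝ) < n := by exact_mod_cast Nat.pos_of_ne_zero hn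
  unfold cr
  generalize ((Nat.choose (a + n) a : ℕ) : ℝ) = x at *
  generalize ((Nat.choose (a + 1 + n) (a + 1) : ℕ) : ℝ) = y at *
  push_cast at *
  field_simp
  linarith

lemma cr_tendsto (m n : ℕ) (hn : n ≠ 0) :
    Filter.Tendsto (fun k : ℕ => cr (m + k) n) Filter.atTop (nhds 0) := by
  refine squeeze_zero (fun k => cr_nonneg _ _) (fun k => ?_)
    tendsto_one_div_add_atTop_nhds_zero_nat
  unfold cr
  rw [one_div]
  refine inv_anti₀ (by positivity) ?_
  have h1 : Nat.choose (m + k + 1) (m + k) ≤ Nat.choose (m + k + n) (m + k) :=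
    Nat.choose_le_choose _ (by omega)
  have h2 : k + 1 ≤ Nat.choose (m + k + n) (m + k) := by
    rw [Nat.choose_succ_self_right] at h1; omega
  exact_mod_cast h2

lemma cr_hasSum (m n : ℕ) (hn : n ≠ 0) :
    HasSum (fun k : ℕ => ((m + k + 1 : ℕ) : ℝ)⁻¹ * cr (m + k + 1) n) ((n : ℝ)⁻¹ * cr m n) := by
  rw [hasSum_iff_tendsto_nat_of_nonneg
    (fun k => mul_nonneg (by positivity) (cr_nonneg _ _))]
  have h : ∀ N : ℕ, ∑ k ∈ range N, ((m + k + 1 : ℕ) : ℝ)⁻¹ * cr (m + k + 1) n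
      = (n : ℝ)⁻¹ * (cr m n - cr (m + N) n) := by
    intro N
    simp_rw [cr_step _ n hn]
    rw [← Finset.mul_sum]
    congr 1
    exact Finset.sum_range_sub' (fun k => cr (m + k) n) N
  simp_rw [h]
  have := ((cr_tendsto m n hn).const_sub (cr m n)).const_mul ((n : ℝ)⁻¹)
  simpa using this

lemma c_sum (m n : ℕ) (hn : n ≠ 0) :
    ∑' a : ℕ, (if m < a then r a * c a n else 0) = r n * c m n := by
  have h := cr_hasSum m n hn
  have h2 : ∑' k : ℕ, r (m + k + 1) * c (m + k + 1) n = r n * c m n := by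
    simp only [r, c]
    rw [← ENNReal.ofReal_mul (by positivity), ← h.tsum_eq, ENNReal.ofReal_tsum_of_nonneg
      (fun k => mul_nonneg (by positivity) (cr_nonneg _ _)) h.summable]
    refine tsum_congr fun k => ?_
    rw [← ENNReal.ofReal_mul (by positivity)]
  have h3 := Summable.sum_add_tsum_nat_add' (k := m + 1)
    (f := fun a : ℕ => if m < a then r a * c a n else 0) ENNReal.summable
  rw [← h2, ← h3, Finset.sum_eq_zero, zero_add]
  · refine tsum_congr fun k => ?_
    rw [if_pos (by omega), show k + (m + 1) = m + k + 1 by ring]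
  · intro i hi
    simp only [Finset.mem_range] at hi
    rw [if_neg (by omega)]

noncomputable def X (f g : ℕ → ℝ≥0∞) : ℝ≥0∞ := ∑' m, ∑' n, f m * g n * c m n

lemma X_comm (f g : ℕ → ℝ≥0∞) : X f g = X g f := by
  unfold X
  rw [ENNReal.tsum_comm]
  refine tsum_congr fun m => tsum_congr fun n => ?_
  rw [c_comm]; ring

lemma X_dl (f : ℕ → ℝ≥0∞) : X f dl = ∑' m, f m := by
  unfold X
  refine tsum_congr fun m => ?_
  rw [tsum_eq_single 0]
  · simp [dl, c_zero]
  · intro b hb; simp [dl, hb]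

lemma X_move (f g : ℕ → ℝ≥0∞) (hf : f 0 = 0) : X (M f) g = X f (T g) := by
  unfold X
  refine tsum_congr fun m => ?_
  by_cases hm : m = 0
  · subst hm; simp [M_zero, hf]
  have h1 : ∀ n, M f m * g n * c m n =
      ∑' b, (if n < b then f m * g n * (r b * c m b) else 0) := by
    intro n
    have := c_sum n m hm
    rw [c_comm n m] at this
    simp only [M]
    rw [show r m * f m * g n * c m n = f m * g n * (r m * c m n) by ring, ← this,
      ← ENNReal.tsum_mul_left]
    refine tsum_congr fun b => ?_
    split_ifs
    · rw [c_comm]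
    · simp
  simp_rw [h1]
  rw [ENNReal.tsum_comm]
  refine tsum_congr fun b => ?_
  simp only [T, M, P_eq]
  rw [show ∀ t, f m * (r b * t) * c m b = t * (f m * (r b * c m b)) from fun t => by ring,
    ← ENNReal.tsum_mul_right]
  refine tsum_congr fun n => ?_
  split_ifs
  · ring
  · simp

lemma X_move' (f g : ℕ → ℝ≥0∞) (hg : g 0 = 0) : X (T f) g = X f (M g) := by
  rw [X_comm, X_comm f, X_move _ _ hg]

noncomputable def e1 := T dl
noncomputable def e2 := T e1
noncomputable def e3 := T e2
noncomputable def e4 := T e3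

lemma e1_eq (n : ℕ) : e1 n = r n := by
  unfold e1
  by_cases h : n = 0
  · subst h; simp [T_zero, r_zero]
  · simp only [T, M, P, dl]
    rw [Finset.sum_ite_eq']
    simp [Nat.pos_of_ne_zero h]

/-- duality for zeta(5) -/
lemma dual5 : ∑' n, M e4 n = ∑' n, M (M (M (M e1))) n := by
  rw [← X_dl (M (M (M (M e1))))]
  rw [X_move _ _ (M_zero _), X_move _ _ (M_zero _), X_move _ _ (M_zero _),
    X_move e1 _ (T_zero _), e1, X_move' _ _ (T_zero _), X_comm, X_dl]
  rfl

lemma dual23 : ∑' n, M (T (M e2)) n = ∑' n, M (M (T (M e1))) n := by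
  rw [← X_dl (M (M (T (M e1))))]
  rw [X_move _ _ (M_zero _), X_move _ _ (T_zero _), X_move' _ _ (T_zero _),
    X_move e1 _ (T_zero _), e1, X_move' _ _ (T_zero _), X_comm, X_dl]
  rfl

lemma dual32 : ∑' n, M (T (T (M e1))) n = ∑' n, M (T (M (M e1))) n := by
  rw [← X_dl (M (T (M (M e1))))]
  rw [X_move _ _ (T_zero _), X_move' _ _ (T_zero _), X_move _ _ (M_zero _),
    X_move e1 _ (T_zero _), e1, X_move' _ _ (T_zero _), X_comm, X_dl]

lemma P_mul (u v : ℕ → ℝ≥0∞) (n : ℕ) :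
    P u n * P v n = P (fun m => u m * P v m) n + P (fun m => v m * P u m) n
      + P (fun m => u m * v m) n := by
  induction n with
  | zero => simp [P]
  | succ n ih =>
    simp only [P, Finset.sum_range_succ] at ih ⊢
    rw [add_mul, mul_add, mul_add, ih]
    ring

lemma P_add (u v : ℕ → ℝ≥0∞) (n : ℕ) : P (fun m => u m + v m) n = P u n + P v n := by
  simp [P, Finset.sum_add_distrib]

lemma P_cmul (k : ℝ≥0∞) (v : ℕ → ℝ≥0∞) (n : ℕ) : P (fun m => k * v m) n = k * P v n := by
  simp [P, Finset.mul_sum]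

lemma Pe1_sq (n : ℕ) : P e1 n * P e1 n = 2 * P e2 n + P (M e1) n := by
  rw [P_mul]
  have h : (fun m => e1 m * P e1 m) = e2 := by
    funext m; rw [e1_eq]; rfl
  have h' : (fun m => e1 m * e1 m) = M e1 := by
    funext m; simp only [M, e1_eq]
  rw [h, h']; ring

lemma Pe12 (n : ℕ) : P e1 n * P e2 n = 3 * P e3 n + P (M e2) n + P (T (M e1)) n := by
  rw [P_mul]
  have h : (fun m => e1 m * P e2 m) = e3 := by
    funext m; rw [e1_eq]; rfl
  have h' : (fun m => e1 m * e2 m) = M e2 := by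
    funext m; simp only [M, e1_eq]
  have h'' : (fun m => e2 m * P e1 m) = fun m => 2 * e3 m + T (M e1) m := by
    funext m
    have : e2 m = r m * P e1 m := rfl
    rw [this, mul_assoc, Pe1_sq]
    have h3 : e3 m = r m * P e2 m := rfl
    have h4 : T (M e1) m = r m * P (M e1) m := rfl
    rw [h3, h4]; ring
  rw [h, h', h'', P_add, P_cmul]; ring

lemma e23 (n : ℕ) : e2 n * e3 n = 3 * M e4 n + M (T (M e2)) n + M (T (T (M e1))) n := by
  have h2 : e2 n = r n * P e1 n := rfl
  have h3 : e3 n = r n * P e2 n := rfl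
  have h4 : M e4 n = r n * (r n * P e3 n) := rfl
  have h5 : M (T (M e2)) n = r n * (r n * P (M e2) n) := rfl
  have h6 : M (T (T (M e1))) n = r n * (r n * P (T (M e1)) n) := rfl
  rw [h2, h3, h4, h5, h6, show r n * P e1 n * (r n * P e2 n) = r n * r n * (P e1 n * P e2 n) by ring,
    Pe12]
  ring

noncomputable def Z (k : ℕ) : ℝ≥0∞ := ∑' n, r n ^ k

lemma Z_mul : Z 2 * Z 3 = (∑' n, M (M (T (M e1))) n) + (∑' n, M (T (M (M e1))) n) + Z 5 := by
  have h : Z 2 * Z 3 = ∑' m, ∑' n, r m ^ 2 * r n ^ 3 := by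
    simp only [Z]
    rw [← ENNReal.tsum_mul_right]
    exact tsum_congr fun m => by rw [ENNReal.tsum_mul_left]
  have hs : ∀ m n : ℕ, r m ^ 2 * r n ^ 3 = (if m < n then r m ^ 2 * r n ^ 3 else 0)
      + (if n < m then r m ^ 2 * r n ^ 3 else 0) + (if n = m then r m ^ 5 else 0) := by
    intro m n
    rcases lt_trichotomy m n with h | h | h
    · rw [if_pos h, if_neg h.not_gt, if_neg h.ne']; ring
    · subst h; simp only [lt_irrefl, if_false, if_true]; ring
    · rw [if_pos h, if_neg h.not_gt, if_neg h.ne]; ring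
  rw [h]
  rw [tsum_congr fun m => tsum_congr fun n => hs m n]
  simp_rw [ENNReal.tsum_add]
  congr 1
  · congr 1
    · rw [ENNReal.tsum_comm]
      refine tsum_congr fun n => ?_
      simp only [M, T, P_eq, e1_eq]
      rw [show ∀ t, r n * (r n * (r n * t)) = r n ^ 3 * t from fun t => by ring,
        ← ENNReal.tsum_mul_left]
      refine tsum_congr fun m => ?_
      split_ifs
      · ring
      · simp
    · refine tsum_congr fun n => ?_
      simp only [M, T, P_eq, e1_eq]
      rw [show ∀ t, r n * (r n * t) = r n ^ 2 * t from fun t => by ring,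
        ← ENNReal.tsum_mul_left]
      refine tsum_congr fun m => ?_
      split_ifs
      · ring
      · simp
  · refine tsum_congr fun m => ?_
    rw [tsum_ite_eq]

lemma sum14 : ∑' n, e1 n * e4 n = Z 5 := by
  have : ∑' n, e1 n * e4 n = ∑' n, M e4 n := tsum_congr fun n => by rw [e1_eq]; rfl
  rw [this, dual5]
  refine tsum_congr fun n => ?_
  simp only [M, e1_eq]; ring

lemma sum23 : ∑' n, e2 n * e3 n = Z 2 * Z 3 + 2 * Z 5 := by
  simp_rw [e23, ENNReal.tsum_add, ENNReal.tsum_mul_left]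
  have : ∑' n, M e4 n = Z 5 := by
    rw [← sum14]; exact tsum_congr fun n => by rw [e1_eq]; rfl
  rw [this, dual23, dual32, Z_mul]
  ring

/-! Power series -/

noncomputable def L : PowerSeries ℝ≥0∞ := PowerSeries.mk r

noncomputable def cf (k n : ℕ) : ℝ≥0∞ := PowerSeries.coeff n (L ^ k)

lemma cf_zero (n : ℕ) : cf 0 n = dl n := by
  simp [cf, dl, PowerSeries.coeff_one]

lemma cf_rec' (k n : ℕ) : ((n + 1 : ℕ) : ℝ≥0∞) * cf (k + 1) (n + 1) = (k + 1 : ℕ) * P (cf k) (n + 1) := by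
  have h : PowerSeries.coeff n (PowerSeries.derivative ℝ≥0∞ (L ^ (k + 1))) =
      PowerSeries.coeff n ((k + 1 : ℕ) • L ^ k • PowerSeries.derivative ℝ≥0∞ L) := by
    rw [Derivation.leibniz_pow]; simp
  rw [PowerSeries.coeff_derivative] at h
  have hL : PowerSeries.derivative ℝ≥0∞ L = PowerSeries.mk 1 := by
    ext j
    rw [PowerSeries.coeff_derivative]
    have := r_mul (j + 1) (by omega)
    push_cast at this
    simp [L, this]
  rw [hL, map_nsmul, smul_eq_mul, PowerSeries.coeff_mul,
    Finset.Nat.sum_antidiagonal_eq_sum_range_succ_mk] at h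
  rw [mul_comm, cf]
  push_cast at h ⊢
  rw [h]
  simp [P, cf]

lemma cf_rec (k n : ℕ) : cf (k + 1) n = (k + 1 : ℕ) * T (cf k) n := by
  cases n with
  | zero =>
    rw [T_zero, mul_zero, cf]
    simp [L, r_zero]
  | succ n =>
    have h := congrArg (fun t => r (n + 1) * t) (cf_rec' k n)
    rw [← mul_assoc, r_mul _ (by omega), one_mul] at h
    rw [h, T, M]; ring

lemma T_cmul (k : ℝ≥0∞) (v : ℕ → ℝ≥0∞) (n : ℕ) : T (fun m => k * v m) n = k * T v n := by
  simp only [T, M, P_cmul]; ring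

lemma cf1 : cf 1 = fun n => 1 * e1 n := by
  funext n; rw [cf_rec, show cf 0 = dl from funext cf_zero]; simp [e1]
lemma cf2 : cf 2 = fun n => 2 * e2 n := by
  funext n; rw [cf_rec, cf1, T_cmul]; simp [e2, one_add_one_eq_two]
lemma cf3 : cf 3 = fun n => 6 * e3 n := by
  funext n; rw [cf_rec, cf2, T_cmul, ← mul_assoc, e3]; norm_num
lemma cf4 : cf 4 = fun n => 24 * e4 n := by
  funext n; rw [cf_rec, cf3, T_cmul, ← mul_assoc, e4]; norm_num

/-! Convolution operators on functions on the integers -/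

noncomputable def K (s : ℤ) : AddMonoid.End (ℤ → ℝ≥0∞) where
  toFun φ x := ∑' n : ℕ, r n * φ (x + s * n)
  map_zero' := by funext x; simp
  map_add' φ ψ := by
    funext x
    simp only [Pi.add_apply, mul_add, ENNReal.tsum_add]

lemma K_apply (s : ℤ) (φ : ℤ → ℝ≥0∞) (x : ℤ) : K s φ x = ∑' n : ℕ, r n * φ (x + s * n) := rfl

lemma K_comm (s t : ℤ) : Commute (K s) (K t) := by
  refine AddMonoidHom.ext fun φ => ?_
  funext x
  show K s (K t φ) x = K t (K s φ) x
  simp only [K_apply, ← ENNReal.tsum_mul_left]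
  rw [ENNReal.tsum_comm]
  refine tsum_congr fun a => tsum_congr fun b => ?_
  rw [show x + s * b + t * a = x + t * a + s * b by ring]; ring

lemma tsum_antidiag (F : ℕ → ℕ → ℝ≥0∞) :
    ∑' a, ∑' b, F a b = ∑' n, ∑ p ∈ HasAntidiagonal.antidiagonal n, F p.1 p.2 := by
  rw [← ENNReal.tsum_prod, ← (Finset.HasAntidiagonal.sigmaAntidiagonalEquivProd (A := ℕ)).tsum_eq,
    ENNReal.tsum_sigma']
  refine tsum_congr fun n => ?_
  rw [tsum_fintype, ← Finset.sum_coe_sort (HasAntidiagonal.antidiagonal n)]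
  rfl

lemma K_pow (s : ℤ) (k : ℕ) (φ : ℤ → ℝ≥0∞) (x : ℤ) :
    (K s ^ k) φ x = ∑' n : ℕ, cf k n * φ (x + s * n) := by
  induction k generalizing x with
  | zero =>
    simp only [cf_zero, dl]
    rw [tsum_eq_single 0]
    · simp
    · intro b hb; simp [hb]
  | succ k ih =>
    rw [pow_succ']
    show K s ((K s ^ k) φ) x = _
    simp only [K_apply, ih, ← ENNReal.tsum_mul_left]
    rw [tsum_antidiag]
    refine tsum_congr fun n => ?_
    rw [cf, pow_succ', PowerSeries.coeff_mul, Finset.sum_mul]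
    refine Finset.sum_congr rfl fun p hp => ?_
    rw [← Finset.HasAntidiagonal.mem_antidiagonal.1 hp]
    simp only [L, PowerSeries.coeff_mk, cf]
    push_cast
    rw [show x + s * (p.1 + p.2 : ℤ) = x + s * p.1 + s * p.2 by ring]
    ring

noncomputable def dz (x : ℤ) : ℝ≥0∞ := if x = 0 then 1 else 0

lemma K_two (i j : ℕ) : (K 1 ^ i * K (-1) ^ j) dz 0 = ∑' n, cf i n * cf j n := by
  show (K 1 ^ i) ((K (-1) ^ j) dz) 0 = _
  rw [K_pow]
  refine tsum_congr fun n => ?_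
  rw [K_pow, tsum_eq_single n]
  · simp [dz]
  · intro b hb
    have : ¬ (0 + 1 * (n : ℤ) + -1 * b = 0) := by omega
    simp only [dz, if_neg this, mul_zero]

noncomputable def f (a : ℤ) : ℝ≥0∞ := ENNReal.ofReal (|(a : ℝ)|⁻¹)

lemma K_sum (φ : ℤ → ℝ≥0∞) (x : ℤ) : (K 1 + K (-1)) φ x = ∑' a : ℤ, f a * φ (x + a) := by
  show K 1 φ x + K (-1) φ x = _
  have h := tsum_of_add_one_of_neg_add_one (f := fun a : ℤ => f a * φ (x + a))
    ENNReal.summable ENNReal.summable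
  rw [h, K_apply, K_apply, tsum_eq_zero_add' ENNReal.summable,
    tsum_eq_zero_add' (f := fun n : ℕ => r n * φ (x + -1 * n)) ENNReal.summable]
  have e1 : ∀ n : ℕ, f ((n : ℤ) + 1) = r (n + 1) := by
    intro n
    simp only [f, r]; push_cast; rw [abs_of_nonneg (by positivity)]
  have e2 : ∀ n : ℕ, f (-((n : ℤ) + 1)) = r (n + 1) := by
    intro n
    simp only [f, r]; push_cast; rw [abs_neg, abs_of_nonneg (by positivity)]
  simp only [e1, e2, r_zero]
  simp [f]

lemma pow_K (k : ℕ) (φ : ℤ → ℝ≥0∞) (x : ℤ) : ((K 1 + K (-1)) ^ k) φ x =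
    ∑' a : Fin k → ℤ, (∏ i, f (a i)) * φ (x + ∑ i, a i) := by
  induction k generalizing x with
  | zero => simp
  | succ k ih =>
    rw [pow_succ']
    show (K 1 + K (-1)) (((K 1 + K (-1)) ^ k) φ) x = _
    rw [K_sum]
    simp only [ih, ← ENNReal.tsum_mul_left]
    rw [← (Fin.consEquiv (fun _ : Fin (k + 1) => ℤ)).tsum_eq, ← ENNReal.tsum_prod]
    refine tsum_congr fun p => ?_
    simp [Fin.consEquiv, Fin.prod_univ_succ, Fin.sum_univ_succ]
    rw [mul_assoc, add_assoc]

lemma main_sum : ∑' a : Fin 5 → ℤ, (∏ i, f (a i)) * dz (∑ i, a i)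
    = 240 * (Z 2 * Z 3 + 3 * Z 5) := by
  have h := pow_K 5 dz 0
  simp only [zero_add] at h
  rw [← h, (K_comm 1 (-1)).add_pow]
  have hc : ∀ i j : ℕ, (K 1 ^ i * K (-1) ^ j * (Nat.choose 5 i : AddMonoid.End (ℤ → ℝ≥0∞))) dz 0
      = (Nat.choose 5 i : ℝ≥0∞) * ∑' n, cf i n * cf j n := by
    intro i j
    rw [← K_two, ← Nat.cast_comm, ← nsmul_eq_mul]
    rw [← nsmul_eq_mul]; rfl
  have h05 : ∑' n, cf 0 n * cf 5 n = 0 := by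
    rw [ENNReal.tsum_eq_zero]
    intro n
    rw [cf_zero, cf_rec 4, dl]
    split_ifs with h
    · subst h; simp [T_zero]
    · simp
  have h50 : ∑' n, cf 5 n * cf 0 n = 0 := by
    rw [← h05]; exact tsum_congr fun n => mul_comm _ _
  have h14 : ∑' n, cf 1 n * cf 4 n = 24 * Z 5 := by
    rw [← sum14, cf1, cf4, ← ENNReal.tsum_mul_left]; exact tsum_congr fun n => by ring
  have h41 : ∑' n, cf 4 n * cf 1 n = 24 * Z 5 := by
    rw [← h14]; exact tsum_congr fun n => mul_comm _ _
  have h23 : ∑' n, cf 2 n * cf 3 n = 12 * (Z 2 * Z 3 + 2 * Z 5) := by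
    rw [← sum23, cf2, cf3, ← ENNReal.tsum_mul_left]; exact tsum_congr fun n => by ring
  have h32 : ∑' n, cf 3 n * cf 2 n = 12 * (Z 2 * Z 3 + 2 * Z 5) := by
    rw [← h23]; exact tsum_congr fun n => mul_comm _ _
  have hsum : ∀ (F : ℕ → AddMonoid.End (ℤ → ℝ≥0∞)),
      (∑ m ∈ range (5 + 1), F m) dz 0 = ∑ m ∈ range (5 + 1), (F m) dz 0 := by
    intro F
    simp only [Finset.sum_range_succ, Finset.sum_range_zero]; rfl
  rw [hsum]
  simp only [hc]
  simp only [Finset.sum_range_succ, Finset.sum_range_zero]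
  norm_num [h05, h50, h14, h41, h23, h32, Nat.choose]
  ring

lemma f_zero : f 0 = 0 := by simp [f]

lemma symMT5_toReal : symMT5 = (∑' a : Fin 5 → ℤ, (∏ i, f (a i)) * dz (∑ i, a i)).toReal := by
  have h1 : ∑' a : Fin 5 → ℤ, (∏ i, f (a i)) * dz (∑ i, a i) =
      ∑' a : {a : Fin 5 → ℤ // (∀ i, a i ≠ 0) ∧ ∑ i, a i = 0},
        ENNReal.ofReal (1 / |∏ i, ((a.1 i : ℝ))|) := by
    have := tsum_subtype {a : Fin 5 → ℤ | (∀ i, a i ≠ 0) ∧ ∑ i, a i = 0}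
      (fun a => ENNReal.ofReal (1 / |∏ i, ((a i : ℝ))|))
    refine Eq.trans ?_ this.symm
    refine tsum_congr fun a => ?_
    rw [Set.indicator_apply]
    split_ifs with h
    · obtain ⟨_, h⟩ := h
      rw [dz, if_pos h, mul_one]
      simp only [f]
      rw [← ENNReal.ofReal_prod_of_nonneg (fun i _ => by positivity), Finset.abs_prod, one_div,
        Finset.prod_inv_distrib]
    · simp only [Set.mem_ofPred_eq, not_and_or, not_forall, not_not] at h
      rcases h with ⟨i, hi⟩ | h
      · rw [Finset.prod_eq_zero (Finset.mem_univ i) (by rw [hi, f_zero]), zero_mul]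
      · rw [dz, if_neg h, mul_zero]
  rw [h1, ENNReal.tsum_toReal_eq (fun _ => ENNReal.ofReal_ne_top), symMT5]
  exact tsum_congr fun a => (ENNReal.toReal_ofReal (by positivity)).symm

lemma Z_eq (k : ℕ) (hk : 1 < k) :
    Z k ≠ ⊤ ∧ (((Z k).toReal : ℝ) : ℂ) = riemannZeta k := by
  have hs : Summable fun n : ℕ => 1 / (n : ℝ) ^ k := Real.summable_one_div_nat_pow.2 hk
  have h : Z k = ENNReal.ofReal (∑' n : ℕ, 1 / (n : ℝ) ^ k) := by
    rw [ENNReal.ofReal_tsum_of_nonneg (fun n => by positivity) hs, Z]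
    refine tsum_congr fun n => ?_
    rw [r, ← ENNReal.ofReal_pow (by positivity), inv_pow, one_div]
  refine ⟨h ▸ ENNReal.ofReal_ne_top, ?_⟩
  rw [h, ENNReal.toReal_ofReal (tsum_nonneg fun n => by positivity),
    zeta_nat_eq_tsum_of_gt_one hk, Complex.ofReal_tsum]
  push_cast
  rfl

end MT5

open MT5 in
/-- `ζ̄_5 = 240(ζ(2)ζ(3) + 3ζ(5))`. -/
theorem symMT5_eq :
    (symMT5 : ℂ) = 240 * (riemannZeta 2 * riemannZeta 3 + 3 * riemannZeta 5) := by
  obtain ⟨t2, h2⟩ := Z_eq 2 (by norm_num)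
  obtain ⟨t3, h3⟩ := Z_eq 3 (by norm_num)
  obtain ⟨t5, h5⟩ := Z_eq 5 (by norm_num)
  push_cast at h2 h3 h5
  rw [symMT5_toReal, main_sum, ENNReal.toReal_mul,
    ENNReal.toReal_add (ENNReal.mul_ne_top t2 t3) (ENNReal.mul_ne_top (by norm_num) t5),
    ENNReal.toReal_mul, ENNReal.toReal_mul, ← h2, ← h3, ← h5]
  simp
end

section
/- The sum over all 6-tuples (a₁, …, a₆) of nonzero integers with a₁ + … + a₆ = 0 of 1/|a₁ a₂ a₃ a₄ a₅ a₆| equals 120(ζ(2)³ + 12ζ(3)² + 21ζ(2)ζ(4) + 62ζ(6)), where ζ is the Riemann zeta function. -/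
/-- `ζ̄_6`: the sum of `1/|a₁ ⋯ a₆|` over all 6-tuples of nonzero integers with
`a₁ + … + a₆ = 0`. -/
noncomputable def symMT6 : ℝ :=
  ∑' a : {a : Fin 6 → ℤ // (∀ i, a i ≠ 0) ∧ ∑ i, a i = 0},
    1 / |∏ i, ((a.1 i : ℝ))|

open Filter Topology

/-- The polynomial `t(t+1)⋯(t+n-1)/n!`. -/
noncomputable def wPoly : ℕ → Polynomial ℝ
  | 0 => 1
  | n + 1 => Polynomial.C (1 / ((n : ℝ) + 1)) * ((Polynomial.X + Polynomial.C (n : ℝ)) * wPoly n)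

/-- Coefficients of the square. -/
noncomputable def qq (m n : ℕ) : ℝ := (wPoly n ^ 2).coeff m

/-- `n!/(c)_n`. -/
noncomputable def rr (c : ℕ) : ℕ → ℝ
  | 0 => 1
  | n + 1 => rr c n * ((n : ℝ) + 1) / ((c : ℝ) + n)

noncomputable def AA (m c : ℕ) : ℝ := ∑' n, rr c n * qq m n

theorem wPoly_coeff_nonneg (n : ℕ) : ∀ m, 0 ≤ (wPoly n).coeff m := by
  induction n with
  | zero => intro m; simp only [wPoly, Polynomial.coeff_one]; split_ifs <;> norm_num
  | succ n ih =>
    intro m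
    simp only [wPoly, Polynomial.coeff_C_mul, add_mul, Polynomial.coeff_add]
    have h1 := ih m
    have h2 : 0 ≤ (Polynomial.X * wPoly n).coeff m := by
      cases m with
      | zero => simp
      | succ m => rw [Polynomial.coeff_X_mul]; exact ih m
    positivity

theorem qq_nonneg (m n : ℕ) : 0 ≤ qq m n := by
  unfold qq
  rw [pow_two, Polynomial.coeff_mul]
  exact Finset.sum_nonneg fun x _ => mul_nonneg (wPoly_coeff_nonneg _ _) (wPoly_coeff_nonneg _ _)

theorem qq_rec (m n : ℕ) : ((n : ℝ) + 1) ^ 2 * qq (m + 2) (n + 1) =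
    qq m n + 2 * n * qq (m + 1) n + n ^ 2 * qq (m + 2) n := by
  unfold qq
  have h : Polynomial.C (((n : ℝ) + 1) ^ 2) * wPoly (n + 1) ^ 2 =
      Polynomial.X ^ 2 * wPoly n ^ 2 + Polynomial.C (2 * (n : ℝ)) * (Polynomial.X * wPoly n ^ 2)
        + Polynomial.C ((n : ℝ) ^ 2) * wPoly n ^ 2 := by
    have h0 : Polynomial.C ((n : ℝ) + 1) * wPoly (n + 1) =
        (Polynomial.X + Polynomial.C (n : ℝ)) * wPoly n := by
      simp only [wPoly]
      rw [← mul_assoc, ← Polynomial.C_mul, mul_one_div_cancel (by positivity)]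
      simp
    rw [Polynomial.C_pow, ← mul_pow, h0]
    simp only [Polynomial.C_mul, Polynomial.C_pow]
    rw [show (Polynomial.C (2 : ℝ)) = 2 from rfl]
    ring
  have := congrArg (fun p => Polynomial.coeff p (m + 2)) h
  simp only [Polynomial.coeff_add, Polynomial.coeff_C_mul, Polynomial.coeff_X_mul,
    Polynomial.coeff_X_pow_mul] at this
  exact this

theorem wPoly_coeff_zero (n : ℕ) : (wPoly (n + 1)).coeff 0 = 0 := by
  induction n with
  | zero => simp [wPoly]
  | succ n ih => rw [wPoly]; simp [Polynomial.mul_coeff_zero, ih]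

theorem qq_zero_zero : qq 0 0 = 1 := by simp [qq, wPoly]
theorem qq_succ_zero (m : ℕ) : qq (m + 1) 0 = 0 := by
  simp [qq, wPoly, Polynomial.coeff_one]
theorem qq_zero_succ (n : ℕ) : qq 0 (n + 1) = 0 := by
  simp [qq, pow_two, Polynomial.mul_coeff_zero, wPoly_coeff_zero]
theorem qq_one (n : ℕ) : qq 1 n = 0 := by
  cases n with
  | zero => exact qq_succ_zero 0
  | succ n =>
    simp [qq, pow_two, Polynomial.coeff_mul, Finset.Nat.antidiagonal_succ, wPoly_coeff_zero]

theorem rr_nonneg (c n : ℕ) : 0 ≤ rr c n := by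
  induction n with
  | zero => simp [rr]
  | succ n ih => simp only [rr]; positivity

theorem rr_succ_le (c n : ℕ) (hc : 1 ≤ c) : rr c (n + 1) ≤ rr c n := by
  have h := rr_nonneg c n
  have hc' : (1 : ℝ) ≤ c := by exact_mod_cast hc
  simp only [rr]
  rw [div_le_iff₀ (by positivity)]
  exact mul_le_mul_of_nonneg_left (by linarith) h

theorem rr_le_one (c n : ℕ) (hc : 1 ≤ c) : rr c n ≤ 1 := by
  induction n with
  | zero => simp [rr]
  | succ n ih => exact (rr_succ_le c n hc).trans ih

theorem rr_le_inv (c n : ℕ) (hc : 1 ≤ c) : rr c (n + 1) ≤ 1 / c := by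
  induction n with
  | zero => simp [rr]
  | succ n ih => exact (rr_succ_le c _ hc).trans ih

theorem rr_one (n : ℕ) : rr 1 n = 1 := by
  induction n with
  | zero => simp [rr]
  | succ n ih => simp only [rr, ih]; push_cast; field_simp; ring

theorem rr_shift (c n : ℕ) (hc : 1 ≤ c) : rr (c + 1) n = rr c n * c / (c + n) := by
  have hc' : (1 : ℝ) ≤ c := by exact_mod_cast hc
  induction n with
  | zero => simp only [rr]; field_simp; simp
  | succ n ih => simp only [rr, ih]; push_cast; field_simp; ring

theorem key_id (m c n : ℕ) (hc : 1 ≤ c) :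
    (c : ℝ) ^ 2 * (rr c n * qq (m + 2) n) - 2 * c * (rr c n * qq (m + 1) n)
      - ((c : ℝ) ^ 2 * (rr (c + 1) n * qq (m + 2) n) - 2 * c * (rr (c + 1) n * qq (m + 1) n)
        + rr (c + 1) n * qq m n)
      = c * (n * (rr c n * qq (m + 2) n))
        - c * ((n + 1 : ℕ) * (rr c (n + 1) * qq (m + 2) (n + 1))) := by
  have hc' : (1 : ℝ) ≤ c := by exact_mod_cast hc
  have h := qq_rec m n
  rw [rr_shift c n hc]
  simp only [rr]
  push_cast
  have e : (c : ℝ) * (((n : ℝ) + 1) * (rr c n * ((n : ℝ) + 1) / ((c : ℝ) + n) * qq (m + 2) (n + 1)))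
     = c * (rr c n / (c + n)) * (((n : ℝ) + 1) ^ 2 * qq (m + 2) (n + 1)) := by
    field_simp
  rw [e, h]
  field_simp
  ring

theorem wPoly_eval_nonneg (n : ℕ) : 0 ≤ (wPoly n).eval (1 / 8) := by
  induction n with
  | zero => simp [wPoly]
  | succ n ih =>
    simp only [wPoly, Polynomial.eval_mul, Polynomial.eval_C, Polynomial.eval_add,
      Polynomial.eval_X]
    positivity

theorem wPoly_eval_bound (n : ℕ) :
    (((n : ℝ) + 1) * (wPoly (n + 1)).eval (1 / 8)) ^ 4 ≤ (n : ℝ) + 1 := by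
  induction n with
  | zero => simp [wPoly]; norm_num
  | succ n ih =>
    have h0 := wPoly_eval_nonneg (n + 1)
    rw [wPoly]
    simp only [Polynomial.eval_mul, Polynomial.eval_C, Polynomial.eval_add,
      Polynomial.eval_X]
    set y := (wPoly (n + 1)).eval (1 / 8) with hy
    push_cast
    have e : ((n : ℝ) + 1 + 1) * (1 / ((n : ℝ) + 1 + 1) * ((1 / 8 + ((n : ℝ) + 1)) * y))
      = ((1 / 8 + ((n : ℝ) + 1)) / ((n : ℝ) + 1)) * (((n : ℝ) + 1) * y) := by field_simp
    rw [e, mul_pow]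
    calc _ ≤ ((1 / 8 + ((n : ℝ) + 1)) / ((n : ℝ) + 1)) ^ 4 * ((n : ℝ) + 1) := by gcongr
      _ ≤ _ := by
        rw [div_pow, div_mul_eq_mul_div, div_le_iff₀ (by positivity)]
        have : (0 : ℝ) ≤ n := by positivity
        generalize (n : ℝ) = x at *
        have h2 : (1 / 8 + (x + 1)) ^ 4 ≤ (x + 1 + 1) * (x + 1) ^ 3 := by
          have : 0 ≤ x ^ 3 := by positivity
          have : 0 ≤ x ^ 2 := by positivity
          nlinarith
        calc _ ≤ (x + 1 + 1) * (x + 1) ^ 3 * (x + 1) := by gcongr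
          _ = _ := by ring

theorem wPoly_sq_bound (n : ℕ) :
    ((n : ℝ) + 1) * (((n : ℝ) + 1) * ((wPoly (n + 1)).eval (1 / 8)) ^ 2) ≤ √((n : ℝ) + 1) := by
  apply Real.le_sqrt_of_sq_le
  refine le_trans (le_of_eq ?_) (wPoly_eval_bound n)
  ring

theorem qq_le (m n : ℕ) : qq m n ≤ 8 ^ m * ((wPoly n).eval (1 / 8)) ^ 2 := by
  have h : qq m n * (1 / 8) ^ m ≤ ((wPoly n).eval (1 / 8)) ^ 2 := by
    rw [← Polynomial.eval_pow, Polynomial.eval_eq_sum_range' (n := m + 1 + (wPoly n ^ 2).natDegree)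
      (by omega)]
    refine Finset.single_le_sum (f := fun i => (wPoly n ^ 2).coeff i * (1 / 8) ^ i) (fun i _ => ?_)
      (Finset.mem_range.2 (by omega))
    exact mul_nonneg (qq_nonneg i n) (by positivity)
  calc qq m n = 8 ^ m * (qq m n * (1 / 8) ^ m) := by
        rw [one_div, inv_pow]; field_simp
    _ ≤ _ := by gcongr

theorem n_qq_le (m n : ℕ) : ((n : ℝ) + 1) * qq m (n + 1) ≤ 8 ^ m * (1 / √((n : ℝ) + 1)) := by
  have h1 := qq_le m (n + 1)
  have h2 := wPoly_sq_bound n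
  have h3 : (0 : ℝ) < √((n : ℝ) + 1) := by positivity
  have h4 : √((n : ℝ) + 1) * √((n : ℝ) + 1) = (n : ℝ) + 1 := Real.mul_self_sqrt (by positivity)
  have h5 : (((n : ℝ) + 1) * ((wPoly (n + 1)).eval (1 / 8)) ^ 2) ≤ 1 / √((n : ℝ) + 1) := by
    rw [le_div_iff₀ h3]
    by_contra! hh
    nlinarith
  calc _ ≤ ((n : ℝ) + 1) * (8 ^ m * ((wPoly (n + 1)).eval (1 / 8)) ^ 2) := by gcongr
    _ = 8 ^ m * (((n : ℝ) + 1) * ((wPoly (n + 1)).eval (1 / 8)) ^ 2) := by ring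
    _ ≤ _ := by gcongr

theorem tendsto_inv_sqrt : Tendsto (fun n : ℕ => 1 / √((n : ℝ) + 1)) atTop (𝓝 0) := by
  have h : Tendsto (fun n : ℕ => √((n : ℝ) + 1)) atTop atTop :=
    Real.tendsto_sqrt_atTop.comp (tendsto_atTop_add_const_right _ _ tendsto_natCast_atTop_atTop)
  simp only [one_div]
  exact h.inv_tendsto_atTop

theorem summable_qq (m : ℕ) : Summable (qq m) := by
  rw [← summable_nat_add_iff 1]
  have hs : Summable (fun n : ℕ => 8 ^ m * (1 / ((n + 1 : ℕ) : ℝ) ^ (3 / 2 : ℝ))) :=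
    ((summable_nat_add_iff 1).2
      (Real.summable_one_div_nat_rpow.2 (by norm_num : (1 : ℝ) < 3 / 2))).mul_left _
  refine Summable.of_nonneg_of_le (fun n => qq_nonneg _ _) (fun n => ?_) hs
  have h := n_qq_le m n
  have e : (((n + 1 : ℕ) : ℝ)) ^ (3 / 2 : ℝ) = ((n : ℝ) + 1) * √((n : ℝ) + 1) := by
    rw [show (3 / 2 : ℝ) = 1 + 1 / 2 by norm_num, Real.rpow_add (by positivity), Real.rpow_one,
      ← Real.sqrt_eq_rpow]
    push_cast; rfl
  rw [e]
  have h3 : (0 : ℝ) < (n : ℝ) + 1 := by positivity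
  calc qq m (n + 1) = (((n : ℝ) + 1) * qq m (n + 1)) / ((n : ℝ) + 1) := by field_simp
    _ ≤ (8 ^ m * (1 / √((n : ℝ) + 1))) / ((n : ℝ) + 1) := by gcongr
    _ = _ := by field_simp

theorem summable_rq (m c : ℕ) (hc : 1 ≤ c) : Summable (fun n => rr c n * qq m n) := by
  refine Summable.of_nonneg_of_le (fun n => mul_nonneg (rr_nonneg _ _) (qq_nonneg _ _))
    (fun n => ?_) (summable_qq m)
  exact mul_le_of_le_one_left (qq_nonneg _ _) (rr_le_one c n hc)

theorem tendsto_nrq (m c : ℕ) (hc : 1 ≤ c) :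
    Tendsto (fun n : ℕ => (n : ℝ) * (rr c n * qq m n)) atTop (𝓝 0) := by
  rw [← tendsto_add_atTop_iff_nat 1]
  have h := (tendsto_inv_sqrt.const_mul ((8 : ℝ) ^ m))
  rw [mul_zero] at h
  refine squeeze_zero (fun n => ?_) (fun n => ?_) h
  · have := rr_nonneg c (n + 1); have := qq_nonneg m (n + 1); positivity
  · refine le_trans ?_ (n_qq_le m n)
    push_cast
    gcongr
    exact mul_le_of_le_one_left (qq_nonneg _ _) (rr_le_one c _ hc)

theorem AA_rec (m c : ℕ) (hc : 1 ≤ c) :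
    (c : ℝ) ^ 2 * AA (m + 2) c - 2 * c * AA (m + 1) c =
      (c : ℝ) ^ 2 * AA (m + 2) (c + 1) - 2 * c * AA (m + 1) (c + 1) + AA m (c + 1) := by
  have H (m c) (hc : 1 ≤ c) : HasSum (fun n => rr c n * qq m n) (AA m c) :=
    (summable_rq m c hc).hasSum
  have h1 := ((H (m + 2) c hc).mul_left ((c : ℝ) ^ 2)).sub ((H (m + 1) c hc).mul_left (2 * (c : ℝ)))
  have h2 := (((H (m + 2) (c + 1) (by omega)).mul_left ((c : ℝ) ^ 2)).sub
    ((H (m + 1) (c + 1) (by omega)).mul_left (2 * (c : ℝ)))).add (H m (c + 1) (by omega))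
  have h3 := (h1.sub h2).tendsto_sum_nat
  simp only [key_id m c _ hc] at h3
  have h4 : Tendsto (fun N : ℕ => ∑ n ∈ Finset.range N, ((c : ℝ) * (n * (rr c n * qq (m + 2) n))
        - c * ((n + 1 : ℕ) * (rr c (n + 1) * qq (m + 2) (n + 1))))) atTop (𝓝 0) := by
    have e (N : ℕ) := Finset.sum_range_sub' (fun n : ℕ => (c : ℝ) * (n * (rr c n * qq (m + 2) n))) N
    simp only [e]
    have := ((tendsto_nrq (m + 2) c hc).const_mul (c : ℝ)).const_sub (0 : ℝ)
    simpa using this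
  have := tendsto_nhds_unique h3 h4
  linarith

theorem AA_zero (c : ℕ) : AA 0 c = 1 := by
  unfold AA
  rw [tsum_eq_single 0]
  · simp [rr, qq_zero_zero]
  · intro n hn
    obtain ⟨k, rfl⟩ := Nat.exists_eq_succ_of_ne_zero hn
    simp [qq_zero_succ]

theorem AA_one (c : ℕ) : AA 1 c = 0 := by simp [AA, qq_one]

theorem AA_tendsto (m : ℕ) : Tendsto (fun N : ℕ => AA (m + 1) (N + 1)) atTop (𝓝 0) := by
  have h : Tendsto (fun N : ℕ => ∑' n, rr (N + 1) n * qq (m + 1) n) atTop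
      (𝓝 (∑' _ : ℕ, (0 : ℝ))) := by
    refine tendsto_tsum_of_dominated_convergence (summable_qq (m + 1)) (fun n => ?_)
      (Eventually.of_forall fun N n => ?_)
    · cases n with
      | zero => simp [qq_succ_zero]
      | succ n =>
        have h := (tendsto_one_div_add_atTop_nhds_zero_nat (𝕜 := ℝ)).mul_const (qq (m + 1) (n + 1))
        rw [zero_mul] at h
        refine squeeze_zero (fun N => mul_nonneg (rr_nonneg _ _) (qq_nonneg _ _)) (fun N => ?_) h
        have := rr_le_inv (N + 1) n (by omega)
        push_cast at this
        exact mul_le_mul_of_nonneg_right this (qq_nonneg _ _)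
    · rw [Real.norm_of_nonneg (mul_nonneg (rr_nonneg _ _) (qq_nonneg _ _))]
      exact mul_le_of_le_one_left (qq_nonneg _ _) (rr_le_one _ n (by omega))
  simpa [AA] using h

/-- Partial sums of zeta. -/
noncomputable def HH (j N : ℕ) : ℝ := ∑ k ∈ Finset.range N, (1 / ((k : ℝ) + 1)) ^ j

theorem AA_expand (N : ℕ) :
    AA 2 1 = AA 2 (N + 1) + HH 2 N ∧
    AA 3 1 = AA 3 (N + 1) + 2 * HH 3 N ∧
    AA 4 1 = AA 4 (N + 1) + HH 2 N * AA 2 (N + 1) + (HH 2 N ^ 2 + 7 * HH 4 N) / 2 ∧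
    AA 5 1 = AA 5 (N + 1) + HH 2 N * AA 3 (N + 1) + 2 * HH 3 N * AA 2 (N + 1)
      + (2 * HH 2 N * HH 3 N + 6 * HH 5 N) ∧
    AA 6 1 = AA 6 (N + 1) + HH 2 N * AA 4 (N + 1) + 2 * HH 3 N * AA 3 (N + 1)
      + (HH 2 N ^ 2 + 7 * HH 4 N) / 2 * AA 2 (N + 1)
      + (HH 2 N ^ 3 + 21 * HH 2 N * HH 4 N + 12 * HH 3 N ^ 2 + 62 * HH 6 N) / 6 := by
  induction N with
  | zero => simp [HH]
  | succ N ih =>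
    obtain ⟨h2, h3, h4, h5, h6⟩ := ih
    have e (j : ℕ) : HH j (N + 1) = HH j N + (1 / ((N : ℝ) + 1)) ^ j := Finset.sum_range_succ _ _
    simp only [e]
    have R (m : ℕ) : AA (m + 2) (N + 1) = 2 * (1 / ((N : ℝ) + 1)) * AA (m + 1) (N + 1) +
      (AA (m + 2) (N + 1 + 1) - 2 * (1 / ((N : ℝ) + 1)) * AA (m + 1) (N + 1 + 1)
        + (1 / ((N : ℝ) + 1)) ^ 2 * AA m (N + 1 + 1)) := by
      have := AA_rec m (N + 1) (by omega)
      push_cast at this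
      field_simp
      linarith
    have r2 := R 0
    have r3 := R 1
    have r4 := R 2
    have r5 := R 3
    have r6 := R 4
    simp only [Nat.reduceAdd, zero_add, AA_zero, AA_one] at r2 r3 r4 r5 r6
    rw [r2] at r3
    rw [r3] at r4
    rw [r4] at r5
    rw [r5] at r6
    rw [r2] at h2
    rw [r3] at h3
    rw [r4, r2] at h4
    rw [r5, r3, r2] at h5
    rw [r6, r4, r3, r2] at h6
    generalize (1 / ((N : ℝ) + 1)) = x at *
    refine ⟨?_, ?_, ?_, ?_, ?_⟩
    · rw [h2]; ring
    · rw [h3]; ring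
    · rw [h4]; ring
    · rw [h5]; ring
    · rw [h6]; ring

theorem HH_tendsto (j : ℕ) (hj : 1 < j) :
    Tendsto (HH j) atTop (𝓝 (∑' k : ℕ, (1 / ((k : ℝ) + 1)) ^ j)) := by
  have h : Summable (fun k : ℕ => (1 / ((k : ℝ) + 1)) ^ j) := by
    have := (summable_nat_add_iff 1).2 (Real.summable_one_div_nat_pow.2 hj)
    refine this.congr fun k => ?_
    push_cast
    rw [one_div_pow]
  exact h.hasSum.tendsto_sum_nat

/-- Real zeta values. -/
noncomputable def zz (j : ℕ) : ℝ := ∑' k : ℕ, (1 / ((k : ℝ) + 1)) ^ j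

theorem AA_six : AA 6 1 = (zz 2 ^ 3 + 21 * zz 2 * zz 4 + 12 * zz 3 ^ 2 + 62 * zz 6) / 6 := by
  have h2 := HH_tendsto 2 (by norm_num)
  have h3 := HH_tendsto 3 (by norm_num)
  have h4 := HH_tendsto 4 (by norm_num)
  have h6 := HH_tendsto 6 (by norm_num)
  have a2 := AA_tendsto 1
  have a3 := AA_tendsto 2
  have a4 := AA_tendsto 3
  have a6 := AA_tendsto 5
  have H := ((((a6.add (h2.mul a4)).add ((h3.const_mul 2).mul a3)).add
    ((((h2.pow 2).add (h4.const_mul 7)).div_const 2).mul a2)).add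
      (((((h2.pow 3).add ((h2.const_mul 21).mul h4)).add ((h3.pow 2).const_mul 12)).add
        (h6.const_mul 62)).div_const 6))
  have e : Tendsto (fun _ : ℕ => AA 6 1) atTop (𝓝 (AA 6 1)) := tendsto_const_nhds
  have := tendsto_nhds_unique (e.congr fun N => (AA_expand N).2.2.2.2) H
  rw [this]
  simp only [zz]
  ring

theorem zz_eq (j : ℕ) (hj : 1 < j) : (zz j : ℂ) = riemannZeta j := by
  rw [zeta_eq_tsum_one_div_nat_add_one_cpow (by simpa using hj), zz, Complex.ofReal_tsum]
  congr 1; ext k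
  push_cast
  rw [Complex.cpow_natCast, one_div_pow]

theorem AA_six' : AA 6 1 = ∑' n, qq 6 n := by simp [AA, rr_one]

/-- The formal series `∑ x^n/n`. -/
noncomputable def LL : PowerSeries ℝ := PowerSeries.mk fun n => 1 / (n : ℝ)

theorem LL_deriv : (1 - PowerSeries.X) * PowerSeries.derivative (R := ℝ) LL = 1 := by
  have : PowerSeries.derivative (R := ℝ) LL = PowerSeries.mk 1 := by
    ext n
    rw [PowerSeries.coeff_derivative, LL, PowerSeries.coeff_mk, PowerSeries.coeff_mk]
    push_cast
    field_simp
    simp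
  rw [this, mul_comm]
  exact PowerSeries.mk_one_mul_one_sub_eq_one ℝ

theorem LL_rec (j n : ℕ) :
    ((n : ℝ) + 1) * PowerSeries.coeff (n + 1) (LL ^ (j + 1)) =
      n * PowerSeries.coeff n (LL ^ (j + 1)) + (j + 1) * PowerSeries.coeff n (LL ^ j) := by
  have h : PowerSeries.derivative (R := ℝ) (LL ^ (j + 1)) =
      PowerSeries.X * PowerSeries.derivative (R := ℝ) (LL ^ (j + 1)) + ((j + 1 : ℕ) : PowerSeries ℝ) * LL ^ j := by
    rw [PowerSeries.derivative_pow, Nat.add_sub_cancel]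
    have := LL_deriv
    linear_combination ((j + 1 : ℕ) : PowerSeries ℝ) * LL ^ j * this
  have h2 := congrArg (PowerSeries.coeff n) h
  rw [map_add, PowerSeries.coeff_derivative, ← nsmul_eq_mul, map_nsmul, nsmul_eq_mul] at h2
  push_cast at h2
  have h3 : PowerSeries.coeff n (PowerSeries.X * PowerSeries.derivative (R := ℝ) (LL ^ (j + 1)))
      = n * PowerSeries.coeff n (LL ^ (j + 1)) := by
    cases n with
    | zero => simp
    | succ n => rw [PowerSeries.coeff_succ_X_mul, PowerSeries.coeff_derivative]; push_cast; ring
  rw [h3] at h2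
  linarith

theorem LL_const (j : ℕ) : PowerSeries.coeff 0 (LL ^ (j + 1)) = 0 := by
  have : PowerSeries.constantCoeff LL = 0 := by
    rw [← PowerSeries.coeff_zero_eq_constantCoeff_apply]; simp [LL]
  simp [this]

theorem LL_coeff (n : ℕ) : ∀ j, PowerSeries.coeff n (LL ^ j) = j.factorial * (wPoly n).coeff j := by
  induction n with
  | zero =>
    intro j
    cases j with
    | zero => simp [wPoly]
    | succ j => rw [LL_const]; simp [wPoly, Polynomial.coeff_one]
  | succ n ih =>
    intro j
    cases j with
    | zero => rw [wPoly_coeff_zero]; simp [PowerSeries.coeff_one]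
    | succ j =>
      have h := LL_rec j n
      rw [ih, ih] at h
      have h2 : (wPoly (n + 1)).coeff (j + 1) =
          1 / ((n : ℝ) + 1) * ((wPoly n).coeff j + n * (wPoly n).coeff (j + 1)) := by
        simp only [wPoly, Polynomial.coeff_C_mul, add_mul, Polynomial.coeff_add,
          Polynomial.coeff_X_mul]
      rw [h2]
      have h3 : (0 : ℝ) < (n : ℝ) + 1 := by positivity
      rw [Nat.factorial_succ] at h ⊢
      push_cast at h ⊢
      field_simp
      linarith

open scoped ENNReal

/-- `1/n` in `[0,∞]`, with value `0` at `0`. -/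
noncomputable def hh (n : ℕ) : ℝ≥0∞ := ENNReal.ofReal (1 / (n : ℝ))

theorem hh_zero : hh 0 = 0 := by simp [hh]

theorem tsum_LL {ι : Type} [Fintype ι] [DecidableEq ι] (n : ℕ) :
    ∑' b : ι → ℕ, (if ∑ i, b i = n then ∏ i, hh (b i) else 0) =
      ENNReal.ofReal (PowerSeries.coeff n (LL ^ Fintype.card ι)) := by
  have h1 : LL ^ Fintype.card ι = ∏ _i : ι, LL := by simp
  rw [h1, PowerSeries.coeff_prod]
  rw [← (Finsupp.equivFunOnFinite (α := ι) (M := ℕ)).tsum_eq]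
  rw [tsum_eq_sum (s := Finset.finsuppAntidiag Finset.univ n)]
  · rw [ENNReal.ofReal_sum_of_nonneg]
    · refine Finset.sum_congr rfl fun l hl => ?_
      rw [Finset.mem_finsuppAntidiag] at hl
      have : ∑ i, (Finsupp.equivFunOnFinite l) i = n := hl.1
      rw [if_pos this, ENNReal.ofReal_prod_of_nonneg]
      · simp [hh, LL]
      · intro i _; simp [LL]
    · intro l _
      exact Finset.prod_nonneg fun i _ => by simp [LL]
  · intro l hl
    rw [if_neg]
    intro h
    exact hl (Finset.mem_finsuppAntidiag.2 ⟨h, Finset.subset_univ _⟩)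

theorem tsum_split (t : Finset (Fin 6)) :
    ∑' b : Fin 6 → ℕ, (if ∑ i ∈ t, b i = ∑ i ∈ Finset.univ \ t, b i then
      (∏ i ∈ t, hh (b i)) * ∏ i ∈ Finset.univ \ t, hh (b i) else 0) =
    ∑' n : ℕ, ENNReal.ofReal (PowerSeries.coeff n (LL ^ t.card)) *
      ENNReal.ofReal (PowerSeries.coeff n (LL ^ (6 - t.card))) := by
  have h1 (b : Fin 6 → ℕ) : (if ∑ i ∈ t, b i = ∑ i ∈ Finset.univ \ t, b i then
      (∏ i ∈ t, hh (b i)) * ∏ i ∈ Finset.univ \ t, hh (b i) else 0) =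
      ∑' n : ℕ, (if ∑ i ∈ t, b i = n then ∏ i ∈ t, hh (b i) else 0) *
        (if ∑ i ∈ Finset.univ \ t, b i = n then ∏ i ∈ Finset.univ \ t, hh (b i) else 0) := by
    rw [tsum_eq_single (∑ i ∈ t, b i)]
    · simp [eq_comm]
    · intro n hn
      rw [if_neg hn.symm, zero_mul]
  simp only [h1]
  rw [ENNReal.tsum_comm]
  congr 1; ext n
  rw [← (Equiv.piEquivPiSubtypeProd (fun i : Fin 6 => i ∈ t) (fun _ => ℕ)).symm.tsum_eq]
  have e1 (x : ({i : Fin 6 // i ∈ t} → ℕ) × ({i : Fin 6 // i ∉ t} → ℕ)) :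
      (if ∑ i ∈ t, (Equiv.piEquivPiSubtypeProd (fun i : Fin 6 => i ∈ t) (fun _ => ℕ)).symm x i = n then
        ∏ i ∈ t, hh ((Equiv.piEquivPiSubtypeProd (fun i : Fin 6 => i ∈ t) (fun _ => ℕ)).symm x i) else 0)
      = if ∑ i, x.1 i = n then ∏ i, hh (x.1 i) else 0 := by
    rw [← Finset.sum_coe_sort t, ← Finset.prod_coe_sort t]
    simp [Equiv.piEquivPiSubtypeProd]
    rfl
  have e2 (x : ({i : Fin 6 // i ∈ t} → ℕ) × ({i : Fin 6 // i ∉ t} → ℕ)) :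
      (if ∑ i ∈ Finset.univ \ t, (Equiv.piEquivPiSubtypeProd (fun i : Fin 6 => i ∈ t) (fun _ => ℕ)).symm x i = n then
        ∏ i ∈ Finset.univ \ t, hh ((Equiv.piEquivPiSubtypeProd (fun i : Fin 6 => i ∈ t) (fun _ => ℕ)).symm x i) else 0)
      = if ∑ i, x.2 i = n then ∏ i, hh (x.2 i) else 0 := by
    rw [Finset.sum_subtype (Finset.univ \ t) (p := fun i => i ∉ t) (F := inferInstance) (by simp),
      Finset.prod_subtype (Finset.univ \ t) (p := fun i => i ∉ t) (F := inferInstance) (by simp)]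
    have (i : {i : Fin 6 // i ∉ t}) :
        (Equiv.piEquivPiSubtypeProd (fun i : Fin 6 => i ∈ t) (fun _ => ℕ)).symm x i = x.2 i := by
      simp [Equiv.piEquivPiSubtypeProd, i.2]
    simp only [this]
  simp only [e1, e2]
  rw [ENNReal.tsum_prod']
  simp only [ENNReal.tsum_mul_left, ENNReal.tsum_mul_right]
  rw [tsum_LL, tsum_LL]
  congr 3
  · simp
  · simp [Fintype.card_subtype_compl]

theorem g_split (a : ℤ) : ENNReal.ofReal (1 / |(a : ℝ)|) = hh a.toNat + hh (-a).toNat := by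
  rcases le_total 0 a with h | h
  · lift a to ℕ using h
    rw [Int.toNat_natCast, show (-(a : ℤ)).toNat = 0 by simp, hh_zero, add_zero]
    simp [hh]
  · obtain ⟨b, hb⟩ := Int.eq_ofNat_of_zero_le (show 0 ≤ -a by omega)
    obtain rfl : a = -(b : ℤ) := by omega
    rw [show (-(b : ℤ)).toNat = 0 by simp, hh_zero, zero_add, neg_neg, Int.toNat_natCast]
    simp [hh]

theorem tsum_sign (t : Finset (Fin 6)) :
    ∑' a : Fin 6 → ℤ, (if ∑ i, a i = 0 then
      (∏ i ∈ t, hh (a i).toNat) * ∏ i ∈ Finset.univ \ t, hh (-(a i)).toNat else 0) =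
    ∑' b : Fin 6 → ℕ, (if ∑ i ∈ t, b i = ∑ i ∈ Finset.univ \ t, b i then
      (∏ i ∈ t, hh (b i)) * ∏ i ∈ Finset.univ \ t, hh (b i) else 0) := by
  let φ : (Fin 6 → ℕ) → (Fin 6 → ℤ) := fun b i => if i ∈ t then (b i : ℤ) else -(b i : ℤ)
  have hφ : Function.Injective φ := by
    intro b b' h
    ext i
    have := congrFun h i
    simp only [φ] at this
    split_ifs at this <;> omega
  have φ1 (b) (i) (hi : i ∈ t) : φ b i = b i := by simp [φ, hi]
  have φ2 (b) (i) (hi : i ∈ Finset.univ \ t) : φ b i = -(b i : ℤ) := by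
    have : i ∉ t := by simpa using hi
    simp [φ, this]
  rw [← hφ.tsum_eq]
  · congr 1; ext b
    have s1 : ∑ i, φ b i = ((∑ i ∈ t, b i : ℕ) : ℤ) - ((∑ i ∈ Finset.univ \ t, b i : ℕ) : ℤ) := by
      rw [← Finset.sum_sdiff (Finset.subset_univ t), Finset.sum_congr rfl (φ1 b),
        Finset.sum_congr rfl (φ2 b)]
      push_cast
      rw [Finset.sum_neg_distrib]
      ring
    have p1 : ∏ i ∈ t, hh (φ b i).toNat = ∏ i ∈ t, hh (b i) :=
      Finset.prod_congr rfl fun i hi => by rw [φ1 b i hi, Int.toNat_natCast]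
    have p2 : ∏ i ∈ Finset.univ \ t, hh (-(φ b i)).toNat = ∏ i ∈ Finset.univ \ t, hh (b i) :=
      Finset.prod_congr rfl fun i hi => by rw [φ2 b i hi, neg_neg, Int.toNat_natCast]
    rw [s1, p1, p2]
    congr 1
    rw [sub_eq_zero, Nat.cast_inj]
  · intro a ha
    rw [Function.mem_support] at ha
    have h0 : (∏ i ∈ t, hh (a i).toNat) * ∏ i ∈ Finset.univ \ t, hh (-(a i)).toNat ≠ 0 := by
      intro h; rw [h] at ha; simp at ha
    obtain ⟨h1, h2⟩ := mul_ne_zero_iff.1 h0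
    rw [Finset.prod_ne_zero_iff] at h1 h2
    refine ⟨fun i => (a i).natAbs, ?_⟩
    ext i
    have hz (k : ℤ) (hk : hh k.toNat ≠ 0) : 0 < k := by
      by_contra! h
      exact hk (by rw [Int.toNat_of_nonpos h, hh_zero])
    by_cases hi : i ∈ t
    · have := hz _ (h1 i hi)
      refine (φ1 (fun i => (a i).natAbs) i hi).trans ?_
      omega
    · have hi' : i ∈ Finset.univ \ t := by simpa using hi
      have := hz _ (h2 i hi')
      refine (φ2 (fun i => (a i).natAbs) i hi').trans ?_
      omega

theorem ennreal_total :
    ∑' a : {a : Fin 6 → ℤ // (∀ i, a i ≠ 0) ∧ ∑ i, a i = 0},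
      ENNReal.ofReal (1 / |∏ i, ((a.1 i : ℝ))|) =
    ∑ t : Finset (Fin 6), ∑' n : ℕ, ENNReal.ofReal (PowerSeries.coeff n (LL ^ t.card)) *
      ENNReal.ofReal (PowerSeries.coeff n (LL ^ (6 - t.card))) := by
  have e1 (a : Fin 6 → ℤ) : ENNReal.ofReal (1 / |∏ i, (a i : ℝ)|) =
      ∏ i, (hh (a i).toNat + hh (-(a i)).toNat) := by
    simp only [← g_split]
    rw [← ENNReal.ofReal_prod_of_nonneg (fun i _ => by positivity), Finset.abs_prod]
    simp
  have e2 : ∑' a : {a : Fin 6 → ℤ // (∀ i, a i ≠ 0) ∧ ∑ i, a i = 0},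
      ENNReal.ofReal (1 / |∏ i, ((a.1 i : ℝ))|) =
      ∑' a : Fin 6 → ℤ, (if ∑ i, a i = 0 then ∏ i, (hh (a i).toNat + hh (-(a i)).toNat) else 0) := by
    rw [← (Subtype.val_injective (p := fun a : Fin 6 → ℤ => (∀ i, a i ≠ 0) ∧ ∑ i, a i = 0)).tsum_eq]
    · congr 1; ext a
      rw [if_pos a.2.2, e1]
    · intro a ha
      rw [Function.mem_support] at ha
      simp only [Subtype.range_coe_subtype, Set.mem_ofPred_eq]
      have hs : ∑ i, a i = 0 := by
        by_contra h; rw [if_neg h] at ha; exact ha rfl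
      rw [if_pos hs, Finset.prod_ne_zero_iff] at ha
      refine ⟨fun i hi => ?_, hs⟩
      apply ha i (Finset.mem_univ i)
      simp [hi, hh_zero]
  rw [e2]
  simp only [← tsum_split, ← tsum_sign]
  rw [← Summable.tsum_finsetSum (fun _ _ => ENNReal.summable)]
  congr 1; ext a
  split_ifs
  · rw [Finset.prod_add, Finset.powerset_univ]
  · simp

theorem LL_coeff_nonneg (n j : ℕ) : 0 ≤ PowerSeries.coeff n (LL ^ j) := by
  rw [LL_coeff]
  have := wPoly_coeff_nonneg n j
  positivity

theorem sum_t (n : ℕ) : ∑ t : Finset (Fin 6), PowerSeries.coeff n (LL ^ t.card) *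
      PowerSeries.coeff n (LL ^ (6 - t.card)) = 720 * qq 6 n := by
  rw [← Finset.powerset_univ, Finset.sum_powerset_apply_card
    (fun k => PowerSeries.coeff n (LL ^ k) * PowerSeries.coeff n (LL ^ (6 - k)))]
  simp only [LL_coeff, qq, pow_two, Polynomial.coeff_mul]
  simp [Finset.sum_range_succ, Finset.Nat.antidiagonal_succ, Nat.factorial, Nat.choose]
  ring

theorem symMT6_real : symMT6 = 720 * AA 6 1 := by
  have h : ∑' a : {a : Fin 6 → ℤ // (∀ i, a i ≠ 0) ∧ ∑ i, a i = 0},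
      ENNReal.ofReal (1 / |∏ i, ((a.1 i : ℝ))|) = ENNReal.ofReal (720 * AA 6 1) := by
    rw [ennreal_total, ← Summable.tsum_finsetSum (fun _ _ => ENNReal.summable), AA_six',
      ← tsum_mul_left, ENNReal.ofReal_tsum_of_nonneg
        (fun n => mul_nonneg (by norm_num) (qq_nonneg _ _)) ((summable_qq 6).mul_left _)]
    refine tsum_congr fun n => ?_
    rw [← sum_t, ENNReal.ofReal_sum_of_nonneg
      (fun t _ => mul_nonneg (LL_coeff_nonneg _ _) (LL_coeff_nonneg _ _))]
    refine Finset.sum_congr rfl fun t _ => ?_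
    rw [ENNReal.ofReal_mul (LL_coeff_nonneg _ _)]
  have h2 := congrArg ENNReal.toReal h
  rw [ENNReal.tsum_toReal_eq (fun _ => ENNReal.ofReal_ne_top), ENNReal.toReal_ofReal] at h2
  · rw [← h2, symMT6]
    congr 1; ext a
    rw [ENNReal.toReal_ofReal (by positivity)]
  · rw [AA_six']
    exact mul_nonneg (by norm_num) (tsum_nonneg fun n => qq_nonneg _ _)

/-- `ζ̄_6 = 120(ζ(2)³ + 12ζ(3)² + 21ζ(2)ζ(4) + 62ζ(6))`. -/
theorem symMT6_eq :
    (symMT6 : ℂ) = 120 * (riemannZeta 2 ^ 3 + 12 * riemannZeta 3 ^ 2 +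
      21 * riemannZeta 2 * riemannZeta 4 + 62 * riemannZeta 6) := by
  have z2 := zz_eq 2 (by norm_num)
  have z3 := zz_eq 3 (by norm_num)
  have z4 := zz_eq 4 (by norm_num)
  have z6 := zz_eq 6 (by norm_num)
  push_cast at z2 z3 z4 z6
  rw [symMT6_real, AA_six, ← z2, ← z3, ← z4, ← z6]
  push_cast
  ring
end
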